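/- arXiv:math/0204112 — 2 statements merged into one kernel-verified Lean document; each statement's English description precedes it below -/
import Mathlib

section
/- Let A and B be m-regular involutive quantales and suppose F : mreg-Hilb_A → mreg-Hilb_B and G : mreg-Hilb_B → mreg-Hilb_A are equivalence *-functors with FG ≅ Id and GF ≅ Id via unitary natural isomorphisms. Then A and B are strongly Morita equivalent; moreover X = F(A) is an imprimitivity A–B bimodule implementing the strong Morita equivalence, and F(−) ≅ (−)⊗̇_A X naturally and unitarily. Conversely, any imprimitivity A–B bimodule X implements such a functorial equivalence. -/
universe u v w

set_option autoImplicit false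

/-- An involutive quantale: a complete lattice with an associative multiplication
distributing over arbitrary joins in both arguments, together with an involution. -/
class InvQuantale (A : Type u) extends CompleteLattice A, Mul A, Star A where
  qmul_assoc : ∀ a b c : A, a * b * c = a * (b * c)
  mul_sSup : ∀ (a : A) (S : Set A), a * sSup S = ⨆ b ∈ S, a * b
  sSup_mul : ∀ (S : Set A) (a : A), sSup S * a = ⨆ b ∈ S, b * a
  qstar_star : ∀ a : A, star (star a) = a
  star_sSup : ∀ S : Set A, star (sSup S) = ⨆ a ∈ S, star a
  qstar_mul : ∀ a b : A, star (a * b) = star b * star a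

namespace Quantale

variable {A : Type u} [InvQuantale A]

theorem mul_iSup {ι : Sort w} (a : A) (f : ι → A) :
    (a * ⨆ i, f i) = ⨆ i, a * f i := by
  rw [iSup, InvQuantale.mul_sSup, iSup_range]

theorem iSup_mul {ι : Sort w} (f : ι → A) (a : A) :
    (⨆ i, f i) * a = ⨆ i, f i * a := by
  rw [iSup, InvQuantale.sSup_mul, iSup_range]

theorem star_iSup {ι : Sort w} (f : ι → A) :
    star (⨆ i, f i) = ⨆ i, star (f i) := by
  rw [iSup, InvQuantale.star_sSup, iSup_range]

end Quantale

/-- A quantale is unital if it has a two-sided unit for the multiplication. -/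
def InvQuantale.IsUnital (A : Type u) [InvQuantale A] : Prop :=
  ∃ e : A, ∀ a : A, e * a = a ∧ a * e = a
section Modules

/-- A right module over an involutive quantale. -/
class QMod (A : Type u) [InvQuantale A] (M : Type v) [CompleteLattice M] where
  act : M → A → M
  act_mul : ∀ (m : M) (a b : A), act m (a * b) = act (act m a) b
  sSup_act : ∀ (S : Set M) (a : A), act (sSup S) a = ⨆ m ∈ S, act m a
  act_sSup : ∀ (m : M) (S : Set A), act m (sSup S) = ⨆ a ∈ S, act m a

/-- The module action `m ⋄ a`. -/
abbrev qact {A : Type u} [InvQuantale A] {M : Type v} [CompleteLattice M] [QMod A M]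
    (m : M) (a : A) : M := QMod.act m a

/-- A right pre-Hilbert module over an involutive quantale. -/
class QPreHilb (A : Type u) [InvQuantale A] (M : Type v) [CompleteLattice M] extends
    QMod A M where
  ip : M → M → A
  ip_mul : ∀ (m n : M) (a : A), ip m n * a = ip m (act n a)
  sSup_ip : ∀ (S : Set M) (n : M), ip (sSup S) n = ⨆ m ∈ S, ip m n
  ip_sSup : ∀ (m : M) (S : Set M), ip m (sSup S) = ⨆ n ∈ S, ip m n
  star_ip : ∀ m n : M, star (ip m n) = ip n m

/-- The inner product `⟨m, n⟩` with values in `A`. -/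
abbrev qip (A : Type u) [InvQuantale A] {M : Type v} [CompleteLattice M] [QPreHilb A M]
    (m n : M) : A := QPreHilb.ip m n

/-- A right Hilbert module: a pre-Hilbert module whose inner product separates points. -/
class QHilb (A : Type u) [InvQuantale A] (M : Type v) [CompleteLattice M] extends
    QPreHilb A M where
  ip_sep : ∀ m n : M, (∀ p : M, ip p m = ip p n) → m = n

variable {A : Type u} [InvQuantale A]

theorem qact_iSup_left {M : Type v} [CompleteLattice M] [QMod A M] {ι : Sort w}
    (f : ι → M) (a : A) : qact (⨆ i, f i) a = ⨆ i, qact (f i) a := by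
  rw [iSup]; exact (QMod.sSup_act _ _).trans iSup_range

theorem qact_iSup_right {M : Type v} [CompleteLattice M] [QMod A M] {ι : Sort w}
    (m : M) (f : ι → A) : qact m (⨆ i, f i) = ⨆ i, qact m (f i) := by
  rw [iSup]; exact (QMod.act_sSup _ _).trans iSup_range

theorem qip_iSup_left {M : Type v} [CompleteLattice M] [QPreHilb A M] {ι : Sort w}
    (f : ι → M) (n : M) : qip A (⨆ i, f i) n = ⨆ i, qip A (f i) n := by
  rw [iSup]; exact (QPreHilb.sSup_ip _ _).trans iSup_range

theorem qip_iSup_right {M : Type v} [CompleteLattice M] [QPreHilb A M] {ι : Sort w}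
    (m : M) (f : ι → M) : qip A m (⨆ i, f i) = ⨆ i, qip A m (f i) := by
  rw [iSup]; exact (QPreHilb.ip_sSup _ _).trans iSup_range

/-- A module is essential if every element is a join of elements of the form `m ⋄ a`. -/
def Essential (A : Type u) [InvQuantale A] (M : Type v) [CompleteLattice M] [QMod A M] :
    Prop :=
  ∀ m : M, m = sSup {x : M | (∃ (p : M) (a : A), x = qact p a) ∧ x ≤ m}

/-- A module is separated by `A` if the right actions separate points. -/
def Separated (A : Type u) [InvQuantale A] (M : Type v) [CompleteLattice M] [QMod A M] :
    Prop :=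
  ∀ m n : M, (∀ a : A, qact m a = qact n a) → m = n

/-- A module is m-regular if it is essential and separated. -/
def MRegMod (A : Type u) [InvQuantale A] (M : Type v) [CompleteLattice M] [QMod A M] :
    Prop :=
  Essential A M ∧ Separated A M

/-- A pre-Hilbert module is full if every element of `A` is a join of inner products. -/
def FullMod (A : Type u) [InvQuantale A] (M : Type v) [CompleteLattice M] [QPreHilb A M] :
    Prop :=
  ∀ a : A, a = sSup {b : A | (∃ m n : M, b = qip A m n) ∧ b ≤ a}

/-- An involutive quantale with multiplication as right action on itself. -/
instance selfQMod : QMod A A where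
  act m a := m * a
  act_mul m a b := (InvQuantale.qmul_assoc m a b).symm
  sSup_act S a := InvQuantale.sSup_mul S a
  act_sSup m S := InvQuantale.mul_sSup m S

/-- An involutive quantale as a pre-Hilbert module over itself, with `⟨a, b⟩ = a⋆ · b`. -/
instance selfQPreHilb : QPreHilb A A where
  ip a b := star a * b
  ip_mul m n a := InvQuantale.qmul_assoc _ _ _
  sSup_ip S n := by
    show star (sSup S) * n = ⨆ m ∈ S, star m * n
    rw [InvQuantale.star_sSup]
    simp only [Quantale.iSup_mul]
  ip_sSup m S := InvQuantale.mul_sSup _ S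
  star_ip m n := by
    rw [InvQuantale.qstar_mul, InvQuantale.qstar_star]

/-- An involutive quantale is m-regular if it is m-regular as a right module over itself. -/
def InvQuantale.MReg (A : Type u) [InvQuantale A] : Prop := MRegMod A A

/-- If right multiplications separate the points of `A`, then `A` is a right Hilbert module
over itself. -/
def selfQHilb (hsep : ∀ a b : A, (∀ c : A, a * c = b * c) → a = b) : QHilb A A where
  toQPreHilb := selfQPreHilb
  ip_sep := by
    intro m n h
    have h2 : ∀ c : A, star m * c = star n * c := by
      intro c
      have h1 : star c * m = star c * n := h c
      have h3 := congrArg star h1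
      rw [InvQuantale.qstar_mul, InvQuantale.qstar_mul, InvQuantale.qstar_star] at h3
      exact h3
    have h4 := hsep _ _ h2
    have h5 := congrArg star h4
    rwa [InvQuantale.qstar_star, InvQuantale.qstar_star] at h5

end Modules
section Pi

variable {A : Type u} [InvQuantale A]

/-- Pointwise right module structure on a power of a module. -/
instance piQMod (J : Type w) (M : Type v) [CompleteLattice M] [QMod A M] :
    QMod A (J → M) where
  act v a := fun j => qact (v j) a
  act_mul v a b := funext fun j => QMod.act_mul (v j) a b
  sSup_act S a := by
    funext j
    show qact (sSup S j) a = _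
    rw [sSup_apply, qact_iSup_left, iSup_subtype]
    simp only [iSup_apply]
  act_sSup v S := by
    funext j
    show qact (v j) (sSup S) = _
    rw [show qact (v j) (sSup S) = ⨆ a ∈ S, qact (v j) a from QMod.act_sSup _ _]
    simp only [iSup_apply]

/-- Pointwise pre-Hilbert structure on a power of a pre-Hilbert module, with inner product
`⟨v, w⟩ = ⨆ j, ⟨v j, w j⟩`.  In particular `A^J` carries the inner product
`⟨(a_j), (b_j)⟩ = ⨆ j, a_j⋆ · b_j`. -/
instance piQPreHilb (J : Type w) (M : Type v) [CompleteLattice M] [QPreHilb A M] :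
    QPreHilb A (J → M) where
  ip v w := ⨆ j, qip A (v j) (w j)
  ip_mul v w a := by
    show (⨆ j, qip A (v j) (w j)) * a = ⨆ j, qip A (v j) (qact (w j) a)
    rw [Quantale.iSup_mul]
    exact iSup_congr fun j => QPreHilb.ip_mul _ _ _
  sSup_ip S w := by
    show (⨆ j, qip A (sSup S j) (w j)) = ⨆ v ∈ S, ⨆ j, qip A (v j) (w j)
    calc (⨆ j, qip A (sSup S j) (w j))
        = ⨆ j, ⨆ f : S, qip A ((f : J → M) j) (w j) := by
          refine iSup_congr fun j => ?_
          rw [sSup_apply, qip_iSup_left]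
      _ = ⨆ f : S, ⨆ j, qip A ((f : J → M) j) (w j) := iSup_comm
      _ = ⨆ v ∈ S, ⨆ j, qip A (v j) (w j) := by rw [iSup_subtype]
  ip_sSup v S := by
    show (⨆ j, qip A (v j) (sSup S j)) = ⨆ w ∈ S, ⨆ j, qip A (v j) (w j)
    calc (⨆ j, qip A (v j) (sSup S j))
        = ⨆ j, ⨆ f : S, qip A (v j) ((f : J → M) j) := by
          refine iSup_congr fun j => ?_
          rw [sSup_apply, qip_iSup_right]
      _ = ⨆ f : S, ⨆ j, qip A (v j) ((f : J → M) j) := iSup_comm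
      _ = ⨆ w ∈ S, ⨆ j, qip A (v j) (w j) := by rw [iSup_subtype]
  star_ip v w := by
    show star (⨆ j, qip A (v j) (w j)) = ⨆ j, qip A (w j) (v j)
    rw [Quantale.star_iSup]
    exact iSup_congr fun j => QPreHilb.star_ip _ _

end Pi

section Maps

variable {A : Type u} [InvQuantale A]

/-- A module homomorphism: a join-preserving map commuting with the action. -/
def IsModHom (A : Type u) [InvQuantale A] {M : Type v} {N : Type w}
    [CompleteLattice M] [CompleteLattice N] [QMod A M] [QMod A N] (f : M → N) : Prop :=
  (∀ S : Set M, f (sSup S) = ⨆ m ∈ S, f m) ∧ ∀ (m : M) (a : A), f (qact m a) = qact (f m) a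

/-- `g` is a ⋆-adjoint of `f`: `⟨f m, n⟩ = ⟨m, g n⟩`. -/
def IsAdjointPair (A : Type u) [InvQuantale A] {M : Type v} {N : Type w}
    [CompleteLattice M] [CompleteLattice N] [QPreHilb A M] [QPreHilb A N]
    (f : M → N) (g : N → M) : Prop :=
  ∀ (m : M) (n : N), qip A (f m) n = qip A m (g n)

/-- A map between (pre-)Hilbert modules is adjointable if it has a ⋆-adjoint. -/
def Adjointable (A : Type u) [InvQuantale A] {M : Type v} {N : Type w}
    [CompleteLattice M] [CompleteLattice N] [QPreHilb A M] [QPreHilb A N]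
    (f : M → N) : Prop :=
  ∃ g : N → M, IsAdjointPair A f g

theorem IsAdjointPair.symm' {M : Type v} {N : Type w}
    [CompleteLattice M] [CompleteLattice N] [QPreHilb A M] [QPreHilb A N]
    {f : M → N} {g : N → M} (h : IsAdjointPair A f g) : IsAdjointPair A g f := by
  intro n m
  calc qip A (g n) m = star (qip A m (g n)) := (QPreHilb.star_ip m (g n)).symm
    _ = star (qip A (f m) n) := by rw [h m n]
    _ = qip A n (f m) := QPreHilb.star_ip _ _

/-- The rank-one operator `Θ_{n,m} : x ↦ n ⋄ ⟨m, x⟩`. -/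
def theta (A : Type u) [InvQuantale A] {M : Type v} {N : Type w}
    [CompleteLattice M] [CompleteLattice N] [QPreHilb A M] [QPreHilb A N]
    (n : N) (m : M) : M → N :=
  fun x => qact n (qip A m x)

/-- A compact operator: an arbitrary (pointwise) join of rank-one operators `Θ_{n,m}`. -/
def IsCompactOp (A : Type u) [InvQuantale A] {M : Type v} {N : Type w}
    [CompleteLattice M] [CompleteLattice N] [QPreHilb A M] [QPreHilb A N]
    (f : M → N) : Prop :=
  ∃ S : Set (N × M), ∀ x : M, f x = ⨆ p ∈ S, theta A p.1 p.2 x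

end Maps

section LeftModules

/-- A left module over an involutive quantale. -/
class QLMod (A : Type u) [InvQuantale A] (M : Type v) [CompleteLattice M] where
  lact : A → M → M
  lact_mul : ∀ (a b : A) (m : M), lact (a * b) m = lact a (lact b m)
  sSup_lact : ∀ (S : Set A) (m : M), lact (sSup S) m = ⨆ a ∈ S, lact a m
  lact_sSup : ∀ (a : A) (S : Set M), lact a (sSup S) = ⨆ m ∈ S, lact a m

/-- A left pre-Hilbert module over an involutive quantale. -/
class QLPreHilb (A : Type u) [InvQuantale A] (M : Type v) [CompleteLattice M] extends
    QLMod A M where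
  lip : M → M → A
  lip_lact : ∀ (a : A) (m n : M), a * lip m n = lip (lact a m) n
  sSup_lip : ∀ (S : Set M) (n : M), lip (sSup S) n = ⨆ m ∈ S, lip m n
  lip_sSup : ∀ (m : M) (S : Set M), lip m (sSup S) = ⨆ n ∈ S, lip m n
  star_lip : ∀ m n : M, star (lip m n) = lip n m

/-- A left Hilbert module. -/
class QLHilb (A : Type u) [InvQuantale A] (M : Type v) [CompleteLattice M] extends
    QLPreHilb A M where
  lip_sep : ∀ m n : M, (∀ p : M, lip m p = lip n p) → m = n

/-- A left module is essential if every element is a join of elements `a • m`. -/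
def LEssential (A : Type u) [InvQuantale A] (M : Type v) [CompleteLattice M] [QLMod A M] :
    Prop :=
  ∀ m : M, m = sSup {x : M | (∃ (a : A) (p : M), x = QLMod.lact a p) ∧ x ≤ m}

/-- A left module is separated by `A` if the left actions separate points. -/
def LSeparated (A : Type u) [InvQuantale A] (M : Type v) [CompleteLattice M] [QLMod A M] :
    Prop :=
  ∀ m n : M, (∀ a : A, QLMod.lact a m = QLMod.lact a n) → m = n

/-- A left pre-Hilbert module is full if every element of `A` is a join of inner products. -/
def LFull (A : Type u) [InvQuantale A] (M : Type v) [CompleteLattice M] [QLPreHilb A M] :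
    Prop :=
  ∀ a : A, a = sSup {b : A | (∃ m n : M, b = QLPreHilb.lip m n) ∧ b ≤ a}

end LeftModules
open CategoryTheory

section Categories

variable {A : Type u} [InvQuantale A]

/-- An object of the category `mreg-Hilb_A` (or `mreg-HMOD_A`): an m-regular right
Hilbert `A`-module. -/
structure HObj (A : Type u) [InvQuantale A] : Type (u + 1) where
  carrier : Type u
  [lat : CompleteLattice carrier]
  [str : QHilb A carrier]
  ess : Essential A carrier
  sep : Separated A carrier

attribute [instance] HObj.lat HObj.str

instance : CoeSort (HObj A) (Type u) := ⟨HObj.carrier⟩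

/-- The category `mreg-Hilb_A` of m-regular right Hilbert `A`-modules with
adjointable maps as morphisms. -/
instance HObj.cat : Category.{u} (HObj A) where
  Hom M N := {f : M.carrier → N.carrier // Adjointable A f}
  id M := ⟨fun m => m, ⟨fun m => m, fun _ _ => rfl⟩⟩
  comp {M N P} f g := ⟨fun m => g.1 (f.1 m), by
    obtain ⟨f', hf⟩ := f.2
    obtain ⟨g', hg⟩ := g.2
    exact ⟨fun p => f' (g' p), fun m p => (hg (f.1 m) p).trans (hf m (g' p))⟩⟩
  id_comp f := Subtype.ext rfl
  comp_id f := Subtype.ext rfl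
  assoc f g h := Subtype.ext rfl

/-- Construct a morphism of `mreg-Hilb_A`. -/
def mkHom {M N : HObj A} (f : M.carrier → N.carrier) (hf : Adjointable A f) : M ⟶ N :=
  ⟨f, hf⟩

/-- The underlying function of a morphism. -/
def homFn {M N : HObj A} (f : M ⟶ N) : M.carrier → N.carrier := f.1

/-- The ⋆-adjoint of a morphism of `mreg-Hilb_A`. -/
noncomputable def hStar {M N : HObj A} (f : M ⟶ N) : N ⟶ M :=
  ⟨Classical.choose f.2, ⟨f.1, (Classical.choose_spec f.2).symm'⟩⟩

theorem hStar_adj {M N : HObj A} (f : M ⟶ N) : IsAdjointPair A f.1 (hStar f).1 :=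
  Classical.choose_spec f.2

/-- The join of a set of morphisms of `mreg-Hilb_A`, computed pointwise. -/
noncomputable def hSup {M N : HObj A} (S : Set (M ⟶ N)) : M ⟶ N :=
  ⟨fun m => ⨆ f ∈ S, (f : M ⟶ N).1 m,
   ⟨fun n => ⨆ f ∈ S, (hStar f).1 n, by
      intro m n
      have L : qip A (⨆ f ∈ S, (f : M ⟶ N).1 m) n
          = ⨆ f ∈ S, qip A ((f : M ⟶ N).1 m) n := by
        rw [qip_iSup_left]
        exact iSup_congr fun f => qip_iSup_left _ _
      have R : qip A m (⨆ f ∈ S, (hStar f).1 n)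
          = ⨆ f ∈ S, qip A m ((hStar f).1 n) := by
        rw [qip_iSup_right]
        exact iSup_congr fun f => qip_iSup_right _ _
      rw [L, R]
      exact iSup_congr fun f => iSup_congr fun _ => hStar_adj f m n⟩⟩

/-- A morphism is unitary if its ⋆-adjoint is a two-sided inverse. -/
noncomputable def IsUnitaryHom {M N : HObj A} (f : M ⟶ N) : Prop :=
  f ≫ hStar f = 𝟙 M ∧ hStar f ≫ f = 𝟙 N

end Categories

section Functors

/-- A (join-preserving) ⋆-functor between the categories `mreg-Hilb_A` and `mreg-Hilb_B`. -/
structure StarFunctor (A B : Type u) [InvQuantale A] [InvQuantale B] : Type (u + 1) where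
  toFunctor : HObj A ⥤ HObj B
  map_star : ∀ {M N : HObj A} (f : M ⟶ N),
    toFunctor.map (hStar f) = hStar (toFunctor.map f)
  map_hSup : ∀ {M N : HObj A} (S : Set (M ⟶ N)),
    toFunctor.map (hSup S) = hSup (toFunctor.map '' S)

/-- Morita equivalence of involutive quantales: there are ⋆-functors `F, G` between
`mreg-Hilb_A` and `mreg-Hilb_B` with `GF ≅ Id` and `FG ≅ Id` via unitary natural
isomorphisms. -/
def Morita (A B : Type u) [InvQuantale A] [InvQuantale B] : Prop :=
  ∃ (F : StarFunctor A B) (G : StarFunctor B A)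
    (η : F.toFunctor ⋙ G.toFunctor ⟶ 𝟭 (HObj A))
    (ζ : G.toFunctor ⋙ F.toFunctor ⟶ 𝟭 (HObj B)),
    (∀ M : HObj A, IsUnitaryHom (η.app M)) ∧ (∀ N : HObj B, IsUnitaryHom (ζ.app N))

variable {A : Type u} [InvQuantale A]

/-- An m-regular involutive quantale as an object of `mreg-Hilb_A`. -/
def selfObj (A : Type u) [InvQuantale A] (hA : InvQuantale.MReg A) : HObj A where
  carrier := A
  lat := inferInstance
  str := selfQHilb hA.2
  ess := hA.1
  sep := hA.2

/-- Left multiplication by `a` as a morphism `A ⟶ A` of `mreg-Hilb_A`. -/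
def lmulHom (A : Type u) [InvQuantale A] (hA : InvQuantale.MReg A) (a : A) :
    selfObj A hA ⟶ selfObj A hA :=
  ⟨fun (b : A) => a * b, ⟨fun (b : A) => Star.star a * b, fun (m n : A) => by
    show Star.star (a * m) * n = Star.star m * (Star.star a * n)
    rw [InvQuantale.qstar_mul, InvQuantale.qmul_assoc]⟩⟩

/-- The left `A`-action `a • z = F(L_a)(z)` on `Z = F(A)` used in the Eilenberg-Watts
theorem. -/
def EWact {A B : Type u} [InvQuantale A] [InvQuantale B] (hA : InvQuantale.MReg A)
    (F : StarFunctor A B) :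
    A → (F.toFunctor.obj (selfObj A hA)).carrier → (F.toFunctor.obj (selfObj A hA)).carrier :=
  fun a z => (F.toFunctor.map (lmulHom A hA a)).1 z

end Functors
section Bimodules

/-- A right Hilbert `A`–`B` bimodule structure: `M` is a right Hilbert `B`-module with a
compatible left `A`-action. -/
structure IsRightHilbBimod (A B : Type u) [InvQuantale A] [InvQuantale B]
    (M : Type u) [CompleteLattice M] [QHilb B M] (lact : A → M → M) : Prop where
  lact_mul : ∀ (a b : A) (m : M), lact (a * b) m = lact a (lact b m)
  sSup_lact : ∀ (S : Set A) (m : M), lact (sSup S) m = ⨆ a ∈ S, lact a m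
  lact_sSup : ∀ (a : A) (S : Set M), lact a (sSup S) = ⨆ m ∈ S, lact a m
  lact_act : ∀ (a : A) (x : M) (b : B), lact a (qact x b) = qact (lact a x) b
  ip_lact : ∀ (a : A) (x y : M), qip B (lact a x) y = qip B x (lact (Star.star a) y)

/-- A left action is essential if every element is a join of elements `a • m`. -/
def LEssentialAct {A : Type u} {M : Type u} [CompleteLattice M] (lact : A → M → M) : Prop :=
  ∀ m : M, m = sSup {x : M | (∃ (a : A) (p : M), x = lact a p) ∧ x ≤ m}

/-- `t : M × N → P` realizes `P` as the interior tensor product `M ⊗̇_A N` of the right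
Hilbert `A`-module `M` with the right Hilbert `A`–`B` bimodule `N` (with left action
`lactN`): `t` is bilinear for joins, its image join-generates `P`, and
`⟨x₁ ⊗ y₁, x₂ ⊗ y₂⟩ = ⟨y₁, ⟨x₁,x₂⟩ • y₂⟩`. -/
structure IsInteriorTensor (A B : Type u) [InvQuantale A] [InvQuantale B]
    {M : Type u} [CompleteLattice M] [QHilb A M]
    {N : Type u} [CompleteLattice N] [QHilb B N] (lactN : A → N → N)
    {P : Type u} [CompleteLattice P] [QHilb B P]
    (t : M → N → P) : Prop where
  ip_t : ∀ (x₁ x₂ : M) (y₁ y₂ : N),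
    qip B (t x₁ y₁) (t x₂ y₂) = qip B y₁ (lactN (qip A x₁ x₂) y₂)
  sSup_t : ∀ (S : Set M) (y : N), t (sSup S) y = ⨆ x ∈ S, t x y
  t_sSup : ∀ (x : M) (S : Set N), t x (sSup S) = ⨆ y ∈ S, t x y
  gen : ∀ p : P, p = sSup {q : P | (∃ x y, q = t x y) ∧ q ≤ p}

/-- A bundled right Hilbert `A`-module. -/
structure HilbMod (A : Type u) [InvQuantale A] : Type (u + 1) where
  carrier : Type u
  [lat : CompleteLattice carrier]
  [str : QHilb A carrier]

attribute [instance] HilbMod.lat HilbMod.str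

/-- A bundled right Hilbert `A`–`B` bimodule. -/
structure BimodObj (A B : Type u) [InvQuantale A] [InvQuantale B] : Type (u + 1) where
  carrier : Type u
  [lat : CompleteLattice carrier]
  [str : QHilb B carrier]
  lact : A → carrier → carrier
  bimod : IsRightHilbBimod A B carrier lact

attribute [instance] BimodObj.lat BimodObj.str

/-- An imprimitivity `A`–`B` bimodule structure on `X`: a full m-regular right Hilbert
`B`-module and full m-regular left Hilbert `A`-module with compatible structures. -/
structure IsImprim (A B : Type u) [InvQuantale A] [InvQuantale B]
    (X : Type u) [CompleteLattice X] [QHilb B X]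
    (lact : A → X → X) (lip : X → X → A) : Prop where
  bimod : IsRightHilbBimod A B X lact
  lip_lact : ∀ (a : A) (x y : X), a * lip x y = lip (lact a x) y
  sSup_lip : ∀ (S : Set X) (y : X), lip (sSup S) y = ⨆ x ∈ S, lip x y
  lip_sSup : ∀ (x : X) (S : Set X), lip x (sSup S) = ⨆ y ∈ S, lip x y
  star_lip : ∀ x y : X, Star.star (lip x y) = lip y x
  lip_sep : ∀ x y : X, (∀ z : X, lip x z = lip y z) → x = y
  rfull : ∀ b : B, b = sSup {c : B | (∃ x y : X, c = qip B x y) ∧ c ≤ b}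
  lfull : ∀ a : A, a = sSup {c : A | (∃ x y : X, c = lip x y) ∧ c ≤ a}
  ress : Essential B X
  rsep : Separated B X
  less : LEssentialAct lact
  lsep : ∀ m n : X, (∀ a : A, lact a m = lact a n) → m = n
  imp1 : ∀ x y z : X, lact (lip x y) z = qact x (qip B y z)
  imp2 : ∀ (x y : X) (b : B), lip (qact x b) y = lip x (qact y (Star.star b))

/-- A bundled imprimitivity `A`–`B` bimodule; `A` and `B` are strongly Morita
equivalent iff such a bimodule exists. -/
structure ImprimObj (A B : Type u) [InvQuantale A] [InvQuantale B] : Type (u + 1) where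
  carrier : Type u
  [lat : CompleteLattice carrier]
  [str : QHilb B carrier]
  lact : A → carrier → carrier
  lip : carrier → carrier → A
  imprim : IsImprim A B carrier lact lip

attribute [instance] ImprimObj.lat ImprimObj.str

end Bimodules

section Constructions

/-- The opposite involutive quantale `A^d`, with multiplication `a ∘ b = b · a`. -/
def InvQuantale.dual (A : Type u) [iq : InvQuantale A] : InvQuantale A :=
  { iq.toCompleteLattice with
    mul := fun a b => b * a
    star := fun a => Star.star a
    qmul_assoc := fun a b c => (InvQuantale.qmul_assoc c b a).symm
    mul_sSup := fun a S => InvQuantale.sSup_mul S a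
    sSup_mul := fun S a => InvQuantale.mul_sSup a S
    qstar_star := fun a => InvQuantale.qstar_star a
    star_sSup := fun S => InvQuantale.star_sSup S
    qstar_mul := fun a b => InvQuantale.qstar_mul b a }

/-- The involutive quantale of `J × J` matrices over `A`, with matrix multiplication
(joins in place of sums) and conjugate-transpose involution. -/
def MatrixQuantale (A : Type u) [InvQuantale A] (J : Type u) :
    InvQuantale (J → J → A) :=
  { (inferInstance : CompleteLattice (J → J → A)) with
    mul := fun X Y i k => ⨆ j, X i j * Y j k
    star := fun X i j => Star.star (X j i)
    qmul_assoc := by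
      intro X Y Z
      funext i l
      show (⨆ k, (⨆ j, X i j * Y j k) * Z k l) = ⨆ j, X i j * ⨆ k, Y j k * Z k l
      calc (⨆ k, (⨆ j, X i j * Y j k) * Z k l)
          = ⨆ k, ⨆ j, (X i j * Y j k) * Z k l := by
            exact iSup_congr fun k => Quantale.iSup_mul _ _
        _ = ⨆ j, ⨆ k, X i j * (Y j k * Z k l) := by
            rw [iSup_comm]
            exact iSup_congr fun j => iSup_congr fun k => InvQuantale.qmul_assoc _ _ _
        _ = ⨆ j, X i j * ⨆ k, Y j k * Z k l := by
            exact iSup_congr fun j => (Quantale.mul_iSup _ _).symm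
    mul_sSup := by
      intro X S
      funext i k
      show (⨆ j, X i j * sSup S j k) = _
      simp only [sSup_apply, iSup_apply, Quantale.mul_iSup]
      rw [iSup_comm]
      rw [iSup_subtype]
      rfl
    sSup_mul := by
      intro S X
      funext i k
      show (⨆ j, sSup S i j * X j k) = _
      simp only [sSup_apply, iSup_apply, Quantale.iSup_mul]
      rw [iSup_comm]
      rw [iSup_subtype]
      rfl
    qstar_star := by
      intro X
      funext i j
      exact InvQuantale.qstar_star _
    star_sSup := by
      intro S
      funext i j
      show Star.star (sSup S j i) = _
      simp only [sSup_apply, iSup_apply, Quantale.star_iSup]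
      rw [iSup_subtype]
    qstar_mul := by
      intro X Y
      funext i l
      show Star.star (⨆ j, X l j * Y j i) = ⨆ j, Star.star (Y j i) * Star.star (X l j)
      rw [Quantale.star_iSup]
      exact iSup_congr fun j => InvQuantale.qstar_mul _ _ }

/-- The property of belonging to the centre of `A`: a join-preserving bimodule
endomorphism that is adjointable for the right and left inner products. -/
def IsCen (A : Type u) [InvQuantale A] (f : A → A) : Prop :=
  (∀ S : Set A, f (sSup S) = ⨆ a ∈ S, f a) ∧
  (∀ a b : A, f (a * b) = f a * b) ∧
  (∀ a b : A, f (a * b) = a * f b) ∧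
  Adjointable A f ∧
  (∃ g : A → A, ∀ a b : A, f a * Star.star b = a * Star.star (g b))

/-- The centre of an m-regular involutive quantale. -/
def Cen (A : Type u) [InvQuantale A] : Type u := {f : A → A // IsCen A f}

end Constructions

namespace SM

section Gen
variable {L : Type u} [CompleteLattice L]

/-- joins of subsets of `S`. -/
def Gen (S : Set L) (l : L) : Prop := ∃ S' : Set L, S' ⊆ S ∧ l = sSup S'

theorem Gen.base {S : Set L} {l : L} (h : l ∈ S) : Gen S l :=
  ⟨{l}, by simpa using h, by simp⟩

theorem Gen.ind {S : Set L} {l : L} (h : Gen S l) (p : L → Prop)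
    (hs : ∀ (ι : Type u) (x : ι → L), (∀ i, p (x i)) → p (⨆ i, x i))
    (hb : ∀ x ∈ S, p x) : p l := by
  obtain ⟨S', h1, rfl⟩ := h
  rw [sSup_eq_iSup']
  exact hs _ _ fun i => hb _ (h1 i.2)

theorem Gen.sSup {S T : Set L} (h : ∀ t ∈ T, Gen S t) : Gen S (sSup T) := by
  choose! f h1 h2 using h
  refine ⟨⋃ t ∈ T, f t, by simpa using h1, ?_⟩
  apply le_antisymm
  · apply sSup_le
    intro t ht
    rw [h2 t ht]
    exact sSup_le_sSup (Set.subset_biUnion_of_mem ht)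
  · apply sSup_le
    intro x hx
    simp only [Set.mem_iUnion] at hx
    obtain ⟨t, ht, hx⟩ := hx
    refine le_trans ?_ (le_sSup ht)
    rw [h2 t ht]
    exact le_sSup hx

theorem Gen.iSup {S : Set L} {ι : Sort v} {x : ι → L} (h : ∀ i, Gen S (x i)) :
    Gen S (⨆ i, x i) := by
  apply Gen.sSup
  rintro _ ⟨i, rfl⟩
  exact h i

theorem Gen.sup {S : Set L} {x y : L} (hx : Gen S x) (hy : Gen S y) : Gen S (x ⊔ y) := by
  rw [← sSup_pair]
  apply Gen.sSup
  rintro t (rfl | rfl)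
  · exact hx
  · exact hy

theorem Gen.bot {S : Set L} : Gen S ⊥ := ⟨∅, by simp, by simp⟩

theorem Gen.eq {S : Set L} {l : L} (h : Gen S l) : l = SupSet.sSup {x | x ∈ S ∧ x ≤ l} := by
  obtain ⟨S', h1, h2⟩ := h
  apply le_antisymm
  · conv_lhs => rw [h2]
    apply sSup_le_sSup
    intro x hx
    exact ⟨h1 hx, by rw [h2]; exact le_sSup hx⟩
  · exact sSup_le fun x hx => hx.2

theorem Gen.of_eq {S : Set L} {l : L} (h : l = SupSet.sSup {x | x ∈ S ∧ x ≤ l}) : Gen S l :=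
  ⟨_, fun _ hx => hx.1, h⟩

theorem Gen.mono {S T : Set L} {l : L} (h : Gen S l) (hST : ∀ x ∈ S, Gen T x) : Gen T l :=
  h.ind _ (fun _ _ => Gen.iSup) hST

end Gen

section Obj
variable {A : Type u} [InvQuantale A]

/-- inner product on an object -/
def hip {M : HObj A} (m n : M.carrier) : A := qip A m n
/-- action on an object -/
def hact {M : HObj A} (m : M.carrier) (a : A) : M.carrier := qact m a
/-- application of a morphism -/
def ap {M N : HObj A} (f : M ⟶ N) (m : M.carrier) : N.carrier := f.1 m

notation:80 f:81 "⊙" m:80 => ap f m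

theorem hom_ext {M N : HObj A} {f g : M ⟶ N} (h : ∀ m, f ⊙ m = g ⊙ m) : f = g :=
  Subtype.ext (funext h)

@[simp] theorem ap_comp {M N P : HObj A} (f : M ⟶ N) (g : N ⟶ P) (m : M.carrier) :
    (f ≫ g) ⊙ m = g ⊙ f ⊙ m := rfl
@[simp] theorem ap_id {M : HObj A} (m : M.carrier) : (𝟙 M : M ⟶ M) ⊙ m = m := rfl

theorem qmul_assoc (a b c : A) : a * b * c = a * (b * c) := InvQuantale.qmul_assoc a b c
@[simp] theorem qss (a : A) : star (star a) = a := InvQuantale.qstar_star a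
@[simp] theorem qsm (a b : A) : star (a * b) = star b * star a := InvQuantale.qstar_mul a b
theorem qstar_inj {a b : A} (h : star a = star b) : a = b := by
  rw [← qss a, h, qss]

theorem qstar_sup (a b : A) : star (a ⊔ b) = star a ⊔ star b := by
  rw [← sSup_pair, InvQuantale.star_sSup, iSup_pair]
theorem qmul_sup (a b c : A) : a * (b ⊔ c) = a * b ⊔ a * c := by
  rw [← sSup_pair, InvQuantale.mul_sSup, iSup_pair]
theorem qsup_mul (a b c : A) : (b ⊔ c) * a = b * a ⊔ c * a := by
  rw [← sSup_pair, InvQuantale.sSup_mul, iSup_pair]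
@[simp] theorem qmul_bot (a : A) : a * ⊥ = ⊥ := by
  rw [← sSup_empty, InvQuantale.mul_sSup]; simp
@[simp] theorem qbot_mul (a : A) : ⊥ * a = ⊥ := by
  rw [← sSup_empty, InvQuantale.sSup_mul]; simp
@[simp] theorem qstar_bot : star (⊥ : A) = ⊥ := by
  rw [← sSup_empty, InvQuantale.star_sSup]; simp

variable {M N P : HObj A}

theorem hip_mul (m n : M.carrier) (a : A) : hip m n * a = hip m (hact n a) :=
  QPreHilb.ip_mul m n a
@[simp] theorem hip_act (m n : M.carrier) (a : A) : hip m (hact n a) = hip m n * a :=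
  (QPreHilb.ip_mul m n a).symm
@[simp] theorem star_hip (m n : M.carrier) : star (hip m n) = hip n m := QPreHilb.star_ip m n
@[simp] theorem hip_act_left (m n : M.carrier) (a : A) : hip (hact m a) n = star a * hip m n := by
  rw [← star_hip, hip_act, qsm, star_hip]
theorem hip_iSup {ι : Sort w} (m : M.carrier) (x : ι → M.carrier) :
    hip m (⨆ i, x i) = ⨆ i, hip m (x i) := qip_iSup_right _ _
theorem hip_iSup_left {ι : Sort w} (m : M.carrier) (x : ι → M.carrier) :
    hip (⨆ i, x i) m = ⨆ i, hip (x i) m := qip_iSup_left _ _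
theorem hip_sup (m x y : M.carrier) : hip m (x ⊔ y) = hip m x ⊔ hip m y := by
  rw [← sSup_pair, sSup_eq_iSup, hip_iSup]; simp only [hip_iSup]; rw [iSup_pair]
theorem hip_sup_left (m x y : M.carrier) : hip (x ⊔ y) m = hip x m ⊔ hip y m := by
  rw [← star_hip, hip_sup, qstar_sup, star_hip, star_hip]
@[simp] theorem hip_bot (m : M.carrier) : hip m ⊥ = ⊥ := by
  rw [← iSup_of_empty (fun _ : Empty => m), hip_iSup]; simp
@[simp] theorem hip_bot_left (m : M.carrier) : hip ⊥ m = ⊥ := by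
  rw [← star_hip, hip_bot, qstar_bot]
theorem hip_mono {m x y : M.carrier} (h : x ≤ y) : hip m x ≤ hip m y := by
  rw [← sup_eq_right.2 h, hip_sup]; exact le_sup_left
theorem hip_mono_left {m x y : M.carrier} (h : x ≤ y) : hip x m ≤ hip y m := by
  rw [← sup_eq_right.2 h, hip_sup_left]; exact le_sup_left
theorem hact_mul (m : M.carrier) (a b : A) : hact m (a * b) = hact (hact m a) b :=
  QMod.act_mul m a b
theorem hact_iSup {ι : Sort w} (m : M.carrier) (x : ι → A) :
    hact m (⨆ i, x i) = ⨆ i, hact m (x i) := qact_iSup_right _ _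
theorem iSup_hact {ι : Sort w} (a : A) (x : ι → M.carrier) :
    hact (⨆ i, x i) a = ⨆ i, hact (x i) a := qact_iSup_left _ _

theorem ext_right {m n : M.carrier} (h : ∀ p : M.carrier, hip p m = hip p n) : m = n :=
  QHilb.ip_sep m n h
theorem ext_left {m n : M.carrier} (h : ∀ p : M.carrier, hip m p = hip n p) : m = n :=
  ext_right fun p => by rw [← star_hip, h, star_hip]
theorem ext_act {m n : M.carrier} (h : ∀ a : A, hact m a = hact n a) : m = n := M.sep m n h

theorem hact_sup_left (x y : M.carrier) (a : A) : hact (x ⊔ y) a = hact x a ⊔ hact y a :=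
  ext_right fun p => by simp only [hip_act, hip_sup, qsup_mul]
theorem hact_sup (x : M.carrier) (a b : A) : hact x (a ⊔ b) = hact x a ⊔ hact x b :=
  ext_right fun p => by simp only [hip_act, hip_sup, qmul_sup]
@[simp] theorem hact_bot_left (a : A) : hact (⊥ : M.carrier) a = ⊥ :=
  ext_right fun p => by simp
@[simp] theorem hact_bot (x : M.carrier) : hact x (⊥ : A) = ⊥ :=
  ext_right fun p => by simp
theorem hact_mono_left {x y : M.carrier} (h : x ≤ y) (a : A) : hact x a ≤ hact y a := by
  rw [← sup_eq_right.2 h, hact_sup_left]; exact le_sup_left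

theorem hess (M : HObj A) (m : M.carrier) : Gen {x | ∃ (p : M.carrier) (a : A), x = hact p a} m :=
  Gen.of_eq (M.ess m)

theorem ess_ind {M : HObj A} (p : M.carrier → Prop)
    (hs : ∀ (ι : Type u) (x : ι → M.carrier), (∀ i, p (x i)) → p (⨆ i, x i))
    (hb : ∀ m a, p (hact m a)) (m : M.carrier) : p m :=
  (hess M m).ind p hs (by rintro _ ⟨m, a, rfl⟩; exact hb m a)

theorem adj (f : M ⟶ N) (m : M.carrier) (n : N.carrier) : hip (f ⊙ m) n = hip m (hStar f ⊙ n) :=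
  hStar_adj f m n
theorem adj' (f : M ⟶ N) (m : M.carrier) (n : N.carrier) : hip n (f ⊙ m) = hip (hStar f ⊙ n) m := by
  rw [← star_hip, adj, star_hip]

theorem ap_iSup {ι : Sort w} (f : M ⟶ N) (x : ι → M.carrier) : f ⊙ (⨆ i, x i) = ⨆ i, f ⊙ x i :=
  ext_right fun p => by simp only [adj', hip_iSup]
theorem ap_sup (f : M ⟶ N) (x y : M.carrier) : f ⊙ (x ⊔ y) = f ⊙ x ⊔ f ⊙ y :=
  ext_right fun p => by simp only [adj', hip_sup]
@[simp] theorem ap_bot (f : M ⟶ N) : f ⊙ ⊥ = ⊥ :=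
  ext_right fun p => by simp only [adj', hip_bot]
theorem ap_mono (f : M ⟶ N) {x y : M.carrier} (h : x ≤ y) : f ⊙ x ≤ f ⊙ y := by
  rw [← sup_eq_right.2 h, ap_sup]; exact le_sup_left
@[simp] theorem ap_act (f : M ⟶ N) (x : M.carrier) (a : A) : f ⊙ hact x a = hact (f ⊙ x) a :=
  ext_right fun p => by simp only [adj', hip_act]

theorem star_eq {f : M ⟶ N} {g : N ⟶ M} (h : ∀ m n, hip (f ⊙ m) n = hip m (g ⊙ n)) : hStar f = g :=
  hom_ext fun n => ext_right fun m => by rw [← h, adj]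

@[simp] theorem hStar_hStar (f : M ⟶ N) : hStar (hStar f) = f :=
  star_eq fun m n => by rw [adj' f]
@[simp] theorem hStar_comp (f : M ⟶ N) (g : N ⟶ P) : hStar (f ≫ g) = hStar g ≫ hStar f :=
  star_eq fun m n => by simp only [ap_comp, adj]
@[simp] theorem hStar_id : hStar (𝟙 M) = 𝟙 M := star_eq fun _ _ => rfl
theorem star_inj {f g : M ⟶ N} (h : hStar f = hStar g) : f = g := by
  rw [← hStar_hStar f, h, hStar_hStar]

/-- morphism from adjoint pair -/
def mkH (f : M.carrier → N.carrier) (g : N.carrier → M.carrier)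
    (h : ∀ m n, hip (f m) n = hip m (g n)) : M ⟶ N := ⟨f, ⟨g, h⟩⟩
@[simp] theorem ap_mk (f : M.carrier → N.carrier) (g : N.carrier → M.carrier)
    (h : ∀ m n, hip (f m) n = hip m (g n)) (m : M.carrier) : mkH f g h ⊙ m = f m := rfl
@[simp] theorem ap_star_mk (f : M.carrier → N.carrier) (g : N.carrier → M.carrier)
    (h : ∀ m n, hip (f m) n = hip m (g n)) (n : N.carrier) : hStar (mkH f g h) ⊙ n = g n :=
  ext_right fun m => by rw [← adj, ap_mk, h]

/-- joins of families of morphisms -/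
noncomputable def hS {ι : Type u} (f : ι → (M ⟶ N)) : M ⟶ N := hSup (Set.range f)
@[simp] theorem ap_hS {ι : Type u} (f : ι → (M ⟶ N)) (m : M.carrier) :
    hS f ⊙ m = ⨆ i, f i ⊙ m := by
  change (⨆ g ∈ Set.range f, g ⊙ m) = _
  rw [iSup_range]
theorem star_hS {ι : Type u} (f : ι → (M ⟶ N)) : hStar (hS f) = hS (fun i => hStar (f i)) :=
  star_eq fun m n => by simp only [ap_hS, hip_iSup_left, hip_iSup, adj]

/-- order of homs, pointwise -/
theorem hom_ext_star {f g : M ⟶ N} (h : ∀ m n, hip n (f ⊙ m) = hip n (g ⊙ m)) : f = g :=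
  hom_ext fun m => ext_right fun n => h m n

variable (hA : InvQuantale.MReg A)

/-- cast into the carrier of the regular object -/
def iS (a : A) : (selfObj A hA).carrier := a
variable {hA} in
/-- cast from the carrier of the regular object -/
def oS (a : (selfObj A hA).carrier) : A := a

@[simp] theorem oS_iS (a : A) : oS (iS hA a) = a := rfl
@[simp] theorem iS_oS (a : (selfObj A hA).carrier) : iS hA (oS a) = a := rfl
variable {hA}
theorem oS_inj {a b : (selfObj A hA).carrier} (h : oS a = oS b) : a = b := h
@[simp] theorem self_hip (a b : (selfObj A hA).carrier) : hip a b = star (oS a) * oS b := rfl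
@[simp] theorem oS_act (a : (selfObj A hA).carrier) (b : A) : oS (hact a b) = oS a * b := rfl
theorem oS_iSup {ι : Sort w} (x : ι → (selfObj A hA).carrier) : oS (⨆ i, x i) = ⨆ i, oS (x i) := rfl
theorem oS_sup (x y : (selfObj A hA).carrier) : oS (x ⊔ y) = oS x ⊔ oS y := rfl
@[simp] theorem oS_bot : oS (⊥ : (selfObj A hA).carrier) = ⊥ := rfl
variable (hA)
theorem iS_act (a b : A) : hact (iS hA a) b = iS hA (a * b) := rfl
theorem iS_iSup {ι : Sort w} (x : ι → A) : iS hA (⨆ i, x i) = ⨆ i, iS hA (x i) := rfl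
theorem iS_sup (x y : A) : iS hA (x ⊔ y) = iS hA x ⊔ iS hA y := rfl
@[simp] theorem iS_bot : iS hA (⊥ : A) = ⊥ := rfl

/-- the map `a ↦ m a` -/
def elt (m : M.carrier) : selfObj A hA ⟶ M :=
  mkH (fun a => hact m (oS a)) (fun n => iS hA (hip m n)) (fun a n => by
    rw [hip_act_left]; rfl)
@[simp] theorem ap_elt (m : M.carrier) (a : (selfObj A hA).carrier) :
    elt hA m ⊙ a = hact m (oS a) := rfl
@[simp] theorem ap_star_elt (m n : M.carrier) : hStar (elt hA m) ⊙ n = iS hA (hip m n) :=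
  ap_star_mk _ _ _ _

@[simp] theorem ap_lmul (a : A) (b : (selfObj A hA).carrier) :
    lmulHom A hA a ⊙ b = iS hA (a * oS b) := rfl
@[simp] theorem star_lmul (a : A) : hStar (lmulHom A hA a) = lmulHom A hA (star a) :=
  star_eq fun m n => by simp [qmul_assoc]

theorem elt_comp (m : M.carrier) (f : M ⟶ N) : elt hA m ≫ f = elt hA (f ⊙ m) :=
  hom_ext fun a => by simp
theorem elt_iS (a : A) : elt hA (iS hA a) = lmulHom A hA a := rfl
theorem lmul_comp (a : A) (f : selfObj A hA ⟶ M) : lmulHom A hA a ≫ f = elt hA (f ⊙ iS hA a) := by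
  rw [← elt_iS, elt_comp]
theorem lmul_elt (a : A) (m : M.carrier) : lmulHom A hA a ≫ elt hA m = elt hA (hact m a) := by
  rw [lmul_comp]; simp
theorem elt_inj {m n : M.carrier} (h : elt hA m = elt hA n) : m = n :=
  ext_act fun a => by rw [← oS_iS hA a, ← ap_elt hA m, h, ap_elt]
theorem elt_iSup {ι : Type u} (x : ι → M.carrier) : elt hA (⨆ i, x i) = hS fun i => elt hA (x i) :=
  hom_ext fun a => by
    rw [ap_hS]; exact iSup_hact _ _
theorem elt_star (m n : M.carrier) : elt hA m ≫ hStar (elt hA n) = lmulHom A hA (hip n m) := by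
  rw [elt_comp, ap_star_elt, elt_iS]
theorem lmul_lmul (a b : A) : lmulHom A hA a ≫ lmulHom A hA b = lmulHom A hA (b * a) := by
  rw [lmul_comp, ap_lmul, elt_iS, oS_iS]
theorem lmul_inj {a b : A} (h : lmulHom A hA a = lmulHom A hA b) : a = b :=
  elt_inj (M := selfObj A hA) hA h
theorem lmul_iSup {ι : Type u} (x : ι → A) :
    lmulHom A hA (⨆ i, x i) = hS fun i => lmulHom A hA (x i) := by
  rw [← elt_iS, iS_iSup, elt_iSup]; rfl

theorem self_ess (hA : InvQuantale.MReg A) (a : A) : Gen {x : A | ∃ p q : A, x = p * q} a :=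
  hess (selfObj A hA) a
theorem self_ess_ind (hA : InvQuantale.MReg A) (p : A → Prop)
    (hs : ∀ (ι : Type u) (x : ι → A), (∀ i, p (x i)) → p (⨆ i, x i))
    (hb : ∀ m a, p (m * a)) (m : A) : p m :=
  (self_ess hA m).ind p hs (by rintro _ ⟨m, a, rfl⟩; exact hb m a)

end Obj

end SM


namespace SM

section SupMap
variable {L : Type u} [CompleteLattice L] {K : Type u} [CompleteLattice K]

/-- join-preserving map -/
def IsSupMap (f : L → K) : Prop := ∀ S : Set L, f (sSup S) = ⨆ m ∈ S, f m

theorem IsSupMap.iSup {f : L → K} (h : IsSupMap f) {ι : Sort w} (x : ι → L) :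
    f (⨆ i, x i) = ⨆ i, f (x i) := by
  rw [_root_.iSup, h, iSup_range]
theorem IsSupMap.sup {f : L → K} (h : IsSupMap f) (x y : L) : f (x ⊔ y) = f x ⊔ f y := by
  rw [← sSup_pair, h, iSup_pair]
theorem IsSupMap.bot {f : L → K} (h : IsSupMap f) : f ⊥ = ⊥ := by
  rw [← sSup_empty, h]; simp
theorem IsSupMap.mono {f : L → K} (h : IsSupMap f) {x y : L} (hxy : x ≤ y) : f x ≤ f y := by
  rw [← sup_eq_right.2 hxy, h.sup]; exact le_sup_left
theorem IsSupMap.le_iff {f : L → K} (h : IsSupMap f) (hi : Function.Injective f) {x y : L} :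
    f x ≤ f y ↔ x ≤ y :=
  ⟨fun hh => sup_eq_right.1 (hi (by rw [h.sup, sup_eq_right.2 hh])), h.mono⟩
theorem isSupMap_of_iSup {f : L → K}
    (h : ∀ (ι : Type u) (x : ι → L), f (⨆ i, x i) = ⨆ i, f (x i)) : IsSupMap f := by
  intro S
  rw [sSup_eq_iSup', h, iSup_subtype]

/-- complete lattice on a sup-closed subset -/
@[reducible] def subLat (S : L → Prop) (hS : ∀ T : Set L, (∀ t ∈ T, S t) → S (sSup T)) :
    CompleteLattice {x // S x} :=
  @completeLatticeOfSup {x // S x} _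
    ⟨fun T => ⟨sSup (Subtype.val '' T), hS _ (by rintro _ ⟨t, -, rfl⟩; exact t.2)⟩⟩
    (fun T => ⟨fun t ht => by
        change t.1 ≤ sSup (Subtype.val '' T)
        exact le_sSup ⟨t, ht, rfl⟩,
      fun b hb => by
        change sSup (Subtype.val '' T) ≤ b.1
        apply sSup_le
        rintro _ ⟨t, ht, rfl⟩
        exact hb ht⟩)

theorem subLat_val (S : L → Prop) (hS : ∀ T : Set L, (∀ t ∈ T, S t) → S (sSup T)) :
    @IsSupMap _ (subLat S hS) _ _ (Subtype.val : {x // S x} → L) := by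
  intro T
  change sSup (Subtype.val '' T) = _
  rw [sSup_image]

end SupMap

section mk
variable {A : Type u} [InvQuantale A]

/-- construct an object from minimal data -/
@[reducible] def mkObj (hA : InvQuantale.MReg A) (P : Type u) [CompleteLattice P] (act : P → A → P)
    (ip : P → P → A)
    (ip_sSup : ∀ p, IsSupMap (ip p)) (star_ip : ∀ p q, star (ip p q) = ip q p)
    (ip_act : ∀ p q a, ip p (act q a) = ip p q * a)
    (ip_sep : ∀ m n, (∀ p, ip p m = ip p n) → m = n)
    (ess : ∀ p, Gen {x | ∃ q a, x = act q a} p) : HObj A where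
  carrier := P
  str :=
    { act := act
      act_mul := fun m a b => ip_sep _ _ fun p => by simp only [ip_act, qmul_assoc]
      sSup_act := fun S a => ip_sep _ _ fun p => by
        rw [ip_act, ip_sSup, Quantale.iSup_mul, (ip_sSup p).iSup]
        refine iSup_congr fun s => ?_
        rw [Quantale.iSup_mul, (ip_sSup p).iSup]
        simp only [ip_act]
      act_sSup := fun m S => ip_sep _ _ fun p => by
        rw [ip_act, InvQuantale.mul_sSup, (ip_sSup p).iSup]
        refine iSup_congr fun s => ?_
        rw [(ip_sSup p).iSup]
        simp only [ip_act]
      ip := ip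
      ip_mul := fun m n a => (ip_act m n a).symm
      sSup_ip := fun S n => by
        rw [← star_ip, ip_sSup, Quantale.star_iSup]
        simp only [Quantale.star_iSup, star_ip]
      ip_sSup := fun m => ip_sSup m
      star_ip := star_ip
      ip_sep := ip_sep }
  ess := fun m => (ess m).eq
  sep := fun m n h => ip_sep _ _ fun p => hA.2 _ _ fun a => by
    change ip p m * a = ip p n * a
    rw [← ip_act, ← ip_act]
    exact congrArg (ip p) (h a)

theorem exists_sub (hA : InvQuantale.MReg A) (M : HObj A) (S : M.carrier → Prop)
    (hsup : ∀ T : Set M.carrier, (∀ t ∈ T, S t) → S (sSup T))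
    (hact' : ∀ m a, S m → S (hact m a))
    (hess' : ∀ m, S m → Gen {x | ∃ p a, S p ∧ x = hact p a} m)
    (hsep : ∀ m n, S m → S n → (∀ p, S p → hip p m = hip p n) → m = n) :
    ∃ (N : HObj A) (val : N.carrier → M.carrier), (∀ n, S (val n)) ∧
      (∀ m, S m → ∃ n, val n = m) ∧ Function.Injective val ∧ IsSupMap val ∧
      (∀ m n, hip (val m) (val n) = hip m n) ∧ (∀ m a, val (hact m a) = hact (val m) a) := by
  let _ := subLat S hsup
  have hv : IsSupMap (Subtype.val : {x // S x} → M.carrier) := subLat_val S hsup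
  refine ⟨mkObj hA {x // S x} (fun m a => ⟨hact m.1 a, hact' _ _ m.2⟩) (fun m n => hip m.1 n.1)
    ?_ ?_ ?_ ?_ ?_, fun x => x.1, fun n => n.2, fun m hm => ⟨⟨m, hm⟩, rfl⟩, Subtype.val_injective,
    hv, fun _ _ => rfl, fun _ _ => rfl⟩
  · intro p T
    simp only [hv T, hip_iSup]
  · intro p q; exact star_hip _ _
  · intro p q a; exact hip_act _ _ _
  · intro m n h
    exact Subtype.ext (hsep _ _ m.2 n.2 fun p hp => h ⟨p, hp⟩)
  · intro p
    obtain ⟨T, hT, h⟩ := hess' p.1 p.2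
    refine ⟨{x | x.1 ∈ T}, ?_, ?_⟩
    · intro x hx
      obtain ⟨q, a, hq, hh⟩ := hT hx
      exact ⟨⟨q, hq⟩, a, Subtype.ext hh⟩
    · apply Subtype.ext
      rw [hv, h]
      apply le_antisymm
      · apply sSup_le
        intro t ht
        obtain ⟨q, a, hq, hh⟩ := hT ht
        have : S t := hh ▸ hact' _ _ hq
        exact le_iSup₂_of_le (⟨t, this⟩ : {x // S x}) ht le_rfl
      · exact iSup₂_le fun x hx => le_sSup hx

theorem exists_prod (hA : InvQuantale.MReg A) (M N : HObj A) :
    ∃ (Q : HObj A) (e : Q.carrier ≃o M.carrier × N.carrier),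
      (∀ x y, hip x y = hip (e x).1 (e y).1 ⊔ hip (e x).2 (e y).2) ∧
      (∀ x a, e (hact x a) = (hact (e x).1 a, hact (e x).2 a)) := by
  refine ⟨mkObj hA (M.carrier × N.carrier) (fun x a => (hact x.1 a, hact x.2 a))
    (fun x y => hip x.1 y.1 ⊔ hip x.2 y.2) ?_ ?_ ?_ ?_ ?_, OrderIso.refl _, fun _ _ => rfl,
    fun _ _ => rfl⟩
  · intro p
    apply isSupMap_of_iSup
    intro ι x
    rw [Prod.fst_iSup, Prod.snd_iSup, hip_iSup, hip_iSup, iSup_sup_eq]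
  · intro p q
    rw [qstar_sup, star_hip, star_hip]
  · intro p q a
    simp only [hip_act, qsup_mul]
  · intro m n h
    apply Prod.ext
    · apply ext_right
      intro p
      simpa using h (p, ⊥)
    · apply ext_right
      intro p
      simpa using h (⊥, p)
  · intro p
    obtain ⟨T1, hT1, h1⟩ := hess M p.1
    obtain ⟨T2, hT2, h2⟩ := hess N p.2
    have e : p = sSup ((fun x => (x, ⊥)) '' T1) ⊔ sSup ((fun x => (⊥, x)) '' T2) := by
      rw [sSup_image, sSup_image]
      apply Prod.ext
      · simp [Prod.fst_iSup, h1, sSup_eq_iSup]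
      · simp [Prod.snd_iSup, h2, sSup_eq_iSup]
    rw [e]
    apply Gen.sup
    · refine ⟨_, ?_, rfl⟩
      rintro _ ⟨x, hx, rfl⟩
      obtain ⟨q, a, rfl⟩ := hT1 hx
      exact ⟨(q, ⊥), a, by simp⟩
    · refine ⟨_, ?_, rfl⟩
      rintro _ ⟨x, hx, rfl⟩
      obtain ⟨q, a, rfl⟩ := hT2 hx
      exact ⟨(⊥, q), a, by simp⟩

theorem exists_quot (hA : InvQuantale.MReg A) (P : Type u) [CompleteLattice P] (act : P → A → P)
    (ip : P → P → A)
    (ip_sSup : ∀ p, IsSupMap (ip p)) (star_ip : ∀ p q, star (ip p q) = ip q p)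
    (ip_act : ∀ p q a, ip p (act q a) = ip p q * a)
    (ess : ∀ p, ∃ S : Set P, S ⊆ {x | ∃ q a, x = act q a} ∧ ∀ r, ip r p = ip r (sSup S)) :
    ∃ (T : HObj A) (tq : P → T.carrier), Function.Surjective tq ∧ IsSupMap tq ∧
      (∀ p q, hip (tq p) (tq q) = ip p q) ∧ (∀ p a, tq (act p a) = hact (tq p) a) := by
  have hΦ : IsSupMap (fun (p : P) (r : P) => ip r p) := by
    intro S
    funext r
    simp only [iSup_apply]
    exact ip_sSup r S
  let R : (P → A) → Prop := fun φ => ∃ p, (fun r => ip r p) = φ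
  let _ := subLat R (by
    intro T hT
    choose! f hf using hT
    refine ⟨⨆ t ∈ T, f t, ?_⟩
    have := hΦ.iSup (fun t => ⨆ (_ : t ∈ T), f t)
    refine this.trans ?_
    rw [sSup_eq_iSup]
    refine iSup_congr fun t => ?_
    refine (hΦ.iSup _).trans ?_
    exact iSup_congr fun ht => hf t ht)
  have hv : IsSupMap (Subtype.val : {x // R x} → P → A) := subLat_val R _
  let tq : P → {x // R x} := fun p => ⟨fun r => ip r p, p, rfl⟩
  have htq : IsSupMap tq := by
    intro S
    apply Subtype.ext
    rw [hv.iSup]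
    simp only [hv.iSup]
    exact hΦ S
  have hsurj : Function.Surjective tq := by
    rintro ⟨_, p, rfl⟩
    exact ⟨p, rfl⟩
  let c : {x // R x} → P := fun x => x.2.choose
  have hc : ∀ x r, ip r (c x) = x.1 r := fun x r => congrFun x.2.choose_spec r
  have hc' : ∀ x, tq (c x) = x := fun x => Subtype.ext (funext fun r => hc x r)
  have hct : ∀ p r, ip r (c (tq p)) = ip r p := fun p r => hc _ _
  have hct' : ∀ p r, ip (c (tq p)) r = ip p r := fun p r => by
    rw [← star_ip, hct, star_ip]
  have tqe : ∀ p q, (∀ r, ip r p = ip r q) → tq p = tq q := fun p q h =>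
    Subtype.ext (funext h)
  refine ⟨mkObj hA {x // R x} (fun x a => tq (act (c x) a)) (fun x y => ip (c x) (c y))
    ?_ ?_ ?_ ?_ ?_, tq, hsurj, htq, ?_, ?_⟩
  · intro p S
    simp only [hc, hv S, iSup_apply]
  · intro p q; exact star_ip _ _
  · intro p q a
    simp only [hct, ip_act]
  · intro m n h
    rw [← hc' m, ← hc' n]
    apply tqe
    intro r
    rw [← hct', h, hct']
  · intro x
    obtain ⟨p, rfl⟩ := hsurj x
    obtain ⟨S, hS, h⟩ := ess p
    refine ⟨tq '' S, ?_, ?_⟩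
    · rintro _ ⟨x, hx, rfl⟩
      obtain ⟨q, a, rfl⟩ := hS hx
      refine ⟨tq q, a, ?_⟩
      apply tqe
      intro r
      simp only [ip_act, hct]
    · rw [tqe _ _ h, htq, sSup_image]
  · intro p q
    exact (hct' _ _).trans (hct _ _)
  · intro p a
    change tq _ = tq _
    apply tqe
    intro r
    simp only [ip_act, hct]

end mk

section lemmas
variable {A : Type u} [InvQuantale A] {M N : HObj A}

theorem ext_gen {I : Type v} {p : I → M.carrier} (hp : ∀ m, Gen (Set.range p) m) {m n : M.carrier}
    (h : ∀ i, hip (p i) m = hip (p i) n) : m = n :=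
  ext_right fun r => (hp r).ind (fun r => hip r m = hip r n)
    (fun ι x hx => by simp only [hip_iSup_left, hx]) (by rintro _ ⟨i, rfl⟩; exact h i)

theorem hom_ext_gen {I : Type v} {p : I → M.carrier} (hp : ∀ m, Gen (Set.range p) m) {f g : M ⟶ N}
    (h : ∀ i, f ⊙ p i = g ⊙ p i) : f = g :=
  hom_ext fun r => (hp r).ind (fun r => f ⊙ r = g ⊙ r)
    (fun ι x hx => by simp only [ap_iSup, hx]) (by rintro _ ⟨i, rfl⟩; exact h i)

theorem gen_eq {I : Type v} {p : I → M.carrier} (hp : ∀ m, Gen (Set.range p) m) (m : M.carrier) :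
    m = ⨆ i, ⨆ (_ : p i ≤ m), p i := by
  apply le_antisymm
  · conv_lhs => rw [(hp m).eq]
    apply sSup_le
    rintro _ ⟨⟨i, rfl⟩, h⟩
    exact le_iSup₂_of_le i h le_rfl
  · exact iSup₂_le fun i h => h

theorem lemA {I J : Type u} {p : I → M.carrier} {q : J → N.carrier}
    (hp : ∀ m, Gen (Set.range p) m) (hq : ∀ m, Gen (Set.range q) m)
    (f : I → N.carrier) (g : J → M.carrier) (h : ∀ i j, hip (f i) (q j) = hip (p i) (g j)) :
    ∃ k : M ⟶ N, (∀ i, k ⊙ p i = f i) ∧ ∀ j, hStar k ⊙ q j = g j := by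
  have key : ∀ m n, hip (⨆ i, ⨆ (_ : p i ≤ m), f i) n = hip m (⨆ j, ⨆ (_ : q j ≤ n), g j) := by
    intro m n
    conv_lhs => rw [gen_eq hq n]
    conv_rhs => rw [gen_eq hp m]
    simp only [hip_iSup, hip_iSup_left, h]
  have e2 : ∀ j, (⨆ j', ⨆ (_ : q j' ≤ q j), g j') = g j := by
    intro j
    apply ext_gen hp
    intro i
    rw [← h]
    conv_rhs => rw [gen_eq hq (q j)]
    simp only [hip_iSup, h]
  have e1 : ∀ i, (⨆ i', ⨆ (_ : p i' ≤ p i), f i') = f i := by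
    intro i
    apply ext_gen hq
    intro j
    apply qstar_inj
    rw [star_hip, star_hip, h, key, e2]
  exact ⟨mkH _ _ key, fun i => e1 i, fun j => (ap_star_mk _ _ key _).trans (e2 j)⟩

theorem lemU {I : Type u} {p : I → M.carrier} {q : I → N.carrier}
    (hp : ∀ m, Gen (Set.range p) m) (hq : ∀ m, Gen (Set.range q) m)
    (h : ∀ i j, hip (q i) (q j) = hip (p i) (p j)) :
    ∃ k : M ⟶ N, (∀ i, k ⊙ p i = q i) ∧ IsUnitaryHom k := by
  obtain ⟨k, h1, h2⟩ := lemA hp hq q p h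
  refine ⟨k, h1, hom_ext_gen hp fun i => ?_, hom_ext_gen hq fun i => ?_⟩
  · simp [h1, h2]
  · simp [h1, h2]

end lemmas
end SM


namespace SM

/-- data of a unitary equivalence -/
structure Eqv (A B : Type u) [InvQuantale A] [InvQuantale B] where
  hA : InvQuantale.MReg A
  hB : InvQuantale.MReg B
  F : StarFunctor A B
  G : StarFunctor B A
  η : F.toFunctor ⋙ G.toFunctor ⟶ CategoryTheory.Functor.id (HObj A)
  ζ : G.toFunctor ⋙ F.toFunctor ⟶ CategoryTheory.Functor.id (HObj B)
  hη : ∀ M : HObj A, IsUnitaryHom (η.app M)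
  hζ : ∀ N : HObj B, IsUnitaryHom (ζ.app N)

namespace Eqv
variable {A B : Type u} [InvQuantale A] [InvQuantale B]

/-- swap the roles -/
def swap (E : Eqv A B) : Eqv B A := ⟨E.hB, E.hA, E.G, E.F, E.ζ, E.η, E.hζ, E.hη⟩

variable (E : Eqv A B)

/-- F on objects -/
def fo (M : HObj A) : HObj B := E.F.toFunctor.obj M
/-- G on objects -/
def go (M : HObj B) : HObj A := E.G.toFunctor.obj M
/-- F on maps -/
def fm {M N : HObj A} (f : M ⟶ N) : E.fo M ⟶ E.fo N := E.F.toFunctor.map f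
/-- G on maps -/
def gm {M N : HObj B} (f : M ⟶ N) : E.go M ⟶ E.go N := E.G.toFunctor.map f
/-- unit -/
def eta (M : HObj A) : E.go (E.fo M) ⟶ M := E.η.app M
/-- counit -/
def zeta (M : HObj B) : E.fo (E.go M) ⟶ M := E.ζ.app M

theorem gm_comp {M N P : HObj B} (f : M ⟶ N) (g : N ⟶ P) : E.gm (f ≫ g) = E.gm f ≫ E.gm g :=
  E.G.toFunctor.map_comp f g
theorem gm_id {M : HObj B} : E.gm (𝟙 M) = 𝟙 _ := E.G.toFunctor.map_id M
theorem gm_star {M N : HObj B} (f : M ⟶ N) : E.gm (hStar f) = hStar (E.gm f) :=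
  E.G.map_star f
theorem gm_hS {M N : HObj B} {ι : Type u} (f : ι → (M ⟶ N)) :
    E.gm (hS f) = hS fun i => E.gm (f i) := by
  refine (E.G.map_hSup _).trans ?_
  rw [← Set.range_comp]
  rfl
theorem fm_comp {M N P : HObj A} (f : M ⟶ N) (g : N ⟶ P) : E.fm (f ≫ g) = E.fm f ≫ E.fm g :=
  E.swap.gm_comp f g
theorem fm_id {M : HObj A} : E.fm (𝟙 M) = 𝟙 _ := E.swap.gm_id
theorem fm_star {M N : HObj A} (f : M ⟶ N) : E.fm (hStar f) = hStar (E.fm f) :=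
  E.swap.gm_star f
theorem fm_hS {M N : HObj A} {ι : Type u} (f : ι → (M ⟶ N)) :
    E.fm (hS f) = hS fun i => E.fm (f i) := E.swap.gm_hS f

theorem eta_nat {M N : HObj A} (f : M ⟶ N) : E.gm (E.fm f) ≫ E.eta N = E.eta M ≫ f :=
  E.η.naturality f
theorem eta1 (M : HObj A) : E.eta M ≫ hStar (E.eta M) = 𝟙 _ := (E.hη M).1
theorem eta2 (M : HObj A) : hStar (E.eta M) ≫ E.eta M = 𝟙 _ := (E.hη M).2
theorem zeta_nat {M N : HObj B} (f : M ⟶ N) : E.fm (E.gm f) ≫ E.zeta N = E.zeta M ≫ f :=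
  E.ζ.naturality f
theorem zeta1 (M : HObj B) : E.zeta M ≫ hStar (E.zeta M) = 𝟙 _ := (E.hζ M).1
theorem zeta2 (M : HObj B) : hStar (E.zeta M) ≫ E.zeta M = 𝟙 _ := (E.hζ M).2

theorem gm_inj {M N : HObj B} {f g : M ⟶ N} (h : E.gm f = E.gm g) : f = g := by
  have h1 := E.zeta_nat f
  rw [h, E.zeta_nat] at h1
  have h2 := congrArg (fun k => hStar (E.zeta M) ≫ k) h1
  simp only [← Category.assoc, zeta2, Category.id_comp] at h2
  exact h2.symm
theorem fm_inj {M N : HObj A} {f g : M ⟶ N} (h : E.fm f = E.fm g) : f = g := E.swap.gm_inj h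

theorem gm_full {M N : HObj B} (k : E.go M ⟶ E.go N) : ∃ h : M ⟶ N, E.gm h = k := by
  refine ⟨hStar (E.zeta M) ≫ E.fm k ≫ E.zeta N, ?_⟩
  apply E.fm_inj
  have h1 := E.zeta_nat (hStar (E.zeta M) ≫ E.fm k ≫ E.zeta N)
  have h2 := congrArg (fun k => k ≫ hStar (E.zeta N)) h1
  simp only [Category.assoc, zeta1, Category.comp_id] at h2
  rw [h2, ← Category.assoc, zeta1, Category.id_comp]
theorem fm_full {M N : HObj A} (k : E.fo M ⟶ E.fo N) : ∃ h : M ⟶ N, E.fm h = k := E.swap.gm_full k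

/-- regular object -/
abbrev oA : HObj A := selfObj A E.hA
/-- regular object -/
abbrev oB : HObj B := selfObj B E.hB
/-- image of the regular object -/
abbrev Z : HObj A := E.go (selfObj B E.hB)
/-- image of the regular object -/
abbrev X : HObj B := E.fo (selfObj A E.hA)

/-- left action -/
def bh (b : B) : E.Z ⟶ E.Z := E.gm (lmulHom B E.hB b)
/-- left action -/
def ah (a : A) : E.X ⟶ E.X := E.fm (lmulHom A E.hA a)
/-- image of an element -/
def g {Y : HObj B} (y : Y.carrier) : E.Z ⟶ E.go Y := E.gm (elt E.hB y)
/-- image of an element, transported -/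
def e {M : HObj A} (y : (E.fo M).carrier) : E.Z ⟶ M := E.g y ≫ E.eta M

theorem bh_star (b : B) : hStar (E.bh b) = E.bh (star b) := by
  rw [bh, ← gm_star, star_lmul]; rfl
theorem bh_bh (a b : B) : E.bh a ≫ E.bh b = E.bh (b * a) := by
  rw [bh, bh, ← gm_comp, lmul_lmul]; rfl
theorem bh_iSup {ι : Type u} (b : ι → B) : E.bh (⨆ i, b i) = hS fun i => E.bh (b i) := by
  rw [bh, lmul_iSup, gm_hS]; rfl
theorem bh_inj {a b : B} (h : E.bh a = E.bh b) : a = b := lmul_inj _ (E.gm_inj h)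

variable {Y Y' : HObj B} {M N : HObj A}

theorem g_iSup {ι : Type u} (y : ι → Y.carrier) : E.g (⨆ i, y i) = hS fun i => E.g (y i) := by
  rw [g, elt_iSup, gm_hS]; rfl
theorem g_inj {y y' : Y.carrier} (h : E.g y = E.g y') : y = y' := elt_inj _ (E.gm_inj h)
theorem bh_g (b : B) (y : Y.carrier) : E.bh b ≫ E.g y = E.g (hact y b) := by
  rw [bh, g, ← gm_comp, lmul_elt]; rfl
theorem g_gm (y : Y.carrier) (k : Y ⟶ Y') : E.g y ≫ E.gm k = E.g (k ⊙ y) := by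
  rw [g, ← gm_comp, elt_comp]; rfl
theorem bh_gm (b : B) (k : selfObj B E.hB ⟶ Y) : E.bh b ≫ E.gm k = E.g (k ⊙ iS E.hB b) := by
  rw [bh, ← gm_comp, lmul_comp]; rfl
theorem g_star (y y' : Y.carrier) : E.g y ≫ hStar (E.g y') = E.bh (hip y' y) := by
  rw [g, g, ← gm_star, ← gm_comp, elt_star]; rfl

theorem e_iSup {ι : Type u} (y : ι → (E.fo M).carrier) : E.e (⨆ i, y i) = hS fun i => E.e (y i) :=
  hom_ext fun z => by
    simp only [e, ap_comp, g_iSup, ap_hS, ap_iSup]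
theorem e_inj {y y' : (E.fo M).carrier} (h : E.e y = E.e y') : y = y' := by
  have h2 := congrArg (fun k => k ≫ hStar (E.eta M)) h
  simp only [e, Category.assoc, eta1, Category.comp_id] at h2
  exact E.g_inj h2
theorem bh_e (b : B) (y : (E.fo M).carrier) : E.bh b ≫ E.e y = E.e (hact y b) := by
  rw [e, ← Category.assoc, bh_g]; rfl
theorem e_comp (y : (E.fo M).carrier) (f : M ⟶ N) : E.e y ≫ f = E.e (E.fm f ⊙ y) := by
  rw [e, Category.assoc, ← eta_nat, ← Category.assoc, g_gm]; rfl
theorem e_star (y y' : (E.fo M).carrier) : E.e y ≫ hStar (E.e y') = E.bh (hip y' y) := by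
  rw [← g_star, e, e, hStar_comp, Category.assoc]
  congr 1
  rw [← Category.assoc, eta1, Category.id_comp]

theorem small_g (m : E.Z ⟶ E.go Y) (b : B) : ∃ y, E.bh b ≫ m = E.g y := by
  obtain ⟨k, rfl⟩ := E.gm_full m
  exact ⟨_, E.bh_gm b k⟩
theorem small_e (m : E.Z ⟶ M) (b : B) : ∃ y, E.bh b ≫ m = E.e y := by
  obtain ⟨y, hy⟩ := E.small_g (m ≫ hStar (E.eta M)) b
  refine ⟨y, ?_⟩
  rw [e, ← hy, Category.assoc, Category.assoc, eta2, Category.comp_id]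

theorem e_lift (k : E.fo M ⟶ E.fo N) : ∃ f : M ⟶ N, E.fm f = k := E.fm_full k

theorem e_sep {h h' : M ⟶ N} (H : ∀ y : (E.fo M).carrier, E.e y ≫ h = E.e y ≫ h') : h = h' := by
  apply E.fm_inj
  apply hom_ext
  intro y
  apply E.e_inj
  rw [← e_comp, ← e_comp, H]

theorem sep_elt {m m' : M.carrier}
    (H : ∀ (y : (E.fo M).carrier) z, hip (E.e y ⊙ z) m = hip (E.e y ⊙ z) m') : m = m' := by
  apply elt_inj E.hA
  apply star_inj
  apply E.e_sep
  intro y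
  apply hom_ext
  intro z
  simp only [ap_comp, ap_star_elt]
  rw [← star_hip, H, star_hip]

/-- apply-level versions -/
theorem ap_bh_bh (a b : B) (z : E.Z.carrier) : E.bh b ⊙ E.bh a ⊙ z = E.bh (b * a) ⊙ z := by
  rw [← bh_bh]; rfl
theorem ap_bh_g (b : B) (y : Y.carrier) (z : E.Z.carrier) :
    E.g y ⊙ E.bh b ⊙ z = E.g (hact y b) ⊙ z := by rw [← bh_g]; rfl
theorem ap_bh_e (b : B) (y : (E.fo M).carrier) (z : E.Z.carrier) :
    E.e y ⊙ E.bh b ⊙ z = E.e (hact y b) ⊙ z := by rw [← bh_e]; rfl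
theorem ap_g_gm (y : Y.carrier) (k : Y ⟶ Y') (z : E.Z.carrier) :
    E.gm k ⊙ E.g y ⊙ z = E.g (k ⊙ y) ⊙ z := by rw [← g_gm]; rfl
theorem ap_e_comp (y : (E.fo M).carrier) (f : M ⟶ N) (z : E.Z.carrier) :
    f ⊙ E.e y ⊙ z = E.e (E.fm f ⊙ y) ⊙ z := by rw [← e_comp]; rfl
theorem ap_g_iSup {ι : Type u} (y : ι → Y.carrier) (z : E.Z.carrier) :
    E.g (⨆ i, y i) ⊙ z = ⨆ i, E.g (y i) ⊙ z := by rw [g_iSup, ap_hS]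
theorem ap_e_iSup {ι : Type u} (y : ι → (E.fo M).carrier) (z : E.Z.carrier) :
    E.e (⨆ i, y i) ⊙ z = ⨆ i, E.e (y i) ⊙ z := by rw [e_iSup, ap_hS]
theorem ap_bh_iSup {ι : Type u} (y : ι → B) (z : E.Z.carrier) :
    E.bh (⨆ i, y i) ⊙ z = ⨆ i, E.bh (y i) ⊙ z := by rw [bh_iSup, ap_hS]
theorem hip_g (y y' : Y.carrier) (z z' : E.Z.carrier) :
    hip (E.g y' ⊙ z') (E.g y ⊙ z) = hip z' (E.bh (hip y' y) ⊙ z) := by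
  rw [adj, ← g_star]; rfl
theorem hip_e (y y' : (E.fo M).carrier) (z z' : E.Z.carrier) :
    hip (E.e y' ⊙ z') (E.e y ⊙ z) = hip z' (E.bh (hip y' y) ⊙ z) := by
  rw [adj, ← e_star]; rfl
theorem hip_bh (b : B) (z z' : E.Z.carrier) :
    hip (E.bh b ⊙ z') z = hip z' (E.bh (star b) ⊙ z) := by
  rw [adj, bh_star]

end Eqv
end SM


namespace SM
namespace Eqv
variable {A B : Type u} [InvQuantale A] [InvQuantale B] (E : Eqv A B)

/-- the set of values -/
def Jset : Set (selfObj A E.hA).carrier :=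
  {a | ∃ (x : (E.fo (selfObj A E.hA)).carrier) (z : E.Z.carrier), a = E.e x ⊙ z}

theorem stage1 : ∃ (J : HObj A) (val : J.carrier → (selfObj A E.hA).carrier)
    (c : E.X.carrier → (E.fo J).carrier),
    (∀ j, Gen E.Jset (val j)) ∧ (∀ m, Gen E.Jset m → ∃ j, val j = m) ∧
    Function.Injective val ∧ IsSupMap val ∧
    (∀ m n, hip (val m) (val n) = hip m n) ∧ (∀ m a, val (hact m a) = hact (val m) a) ∧
    (∀ x z, val (E.e (c x) ⊙ z) = E.e x ⊙ z) ∧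
    (Function.Injective c) ∧ IsSupMap c ∧ (∀ x b, c (hact x b) = hact (c x) b) ∧
    (∀ x x', hip (c x) (c x') = hip x x') ∧
    (∀ v v', (∀ x, hip (c x) v = hip (c x) v') → v = v') := by
  obtain ⟨J, val, h1, h2, h3, h4, h5, h6⟩ := exists_sub E.hA (selfObj A E.hA) (Gen E.Jset)
    (fun T hT => Gen.sSup hT)
    (fun m a hm => by
      refine hm.ind (fun m => Gen E.Jset (hact m a)) ?_ ?_
      · intro ι x hx
        rw [iSup_hact]
        exact Gen.iSup hx
      · rintro _ ⟨x, z, rfl⟩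
        exact Gen.base ⟨x, hact z a, (ap_act _ _ _).symm⟩)
    (fun m hm => by
      refine hm.mono ?_
      rintro _ ⟨x, z, rfl⟩
      refine ess_ind (fun z => Gen {y | ∃ p a, Gen E.Jset p ∧ y = hact p a} (E.e x ⊙ z)) ?_ ?_ z
      · intro ι z hz
        rw [ap_iSup]
        exact Gen.iSup hz
      · intro z a
        exact Gen.base ⟨E.e x ⊙ z, a, Gen.base ⟨x, z, rfl⟩, ap_act _ _ _⟩)
    (fun m n _ _ h => E.sep_elt fun y z => h _ (Gen.base ⟨y, z, rfl⟩))
  have hc0 : ∀ x : E.X.carrier, ∃ v : (E.fo J).carrier, ∀ z, val (E.e v ⊙ z) = E.e x ⊙ z := by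
    refine ess_ind _ ?_ ?_
    · intro ι x hx
      choose v hv using hx
      refine ⟨⨆ i, v i, fun z => ?_⟩
      have e1 : E.e (⨆ i, x i) ⊙ z = ⨆ i, E.e (x i) ⊙ z := E.ap_e_iSup x z
      rw [ap_e_iSup, h4.iSup, e1]
      simp only [hv]
    · intro x b
      have : ∀ z, ∃ j, val j = E.e x ⊙ z := fun z => h2 _ (Gen.base ⟨x, z, rfl⟩)
      choose φ hφ using this
      let m : E.Z ⟶ J := mkH φ (fun j => hStar (E.e x) ⊙ val j) (fun z j => by
        rw [← h5, hφ, adj])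
      obtain ⟨v, hv⟩ := E.small_e m b
      refine ⟨v, fun z => ?_⟩
      rw [← hv]
      change val (φ _) = _
      rw [hφ]
      exact E.ap_bh_e b x z
  choose c hc using hc0
  have hce : ∀ v x, (∀ z, val (E.e v ⊙ z) = E.e x ⊙ z) → v = c x := fun v x h =>
    E.e_inj (hom_ext fun z => h3 (by rw [h, hc]))
  refine ⟨J, val, c, h1, h2, h3, h4, h5, h6, hc, ?_, ?_, ?_, ?_, ?_⟩
  · intro x x' h
    exact E.e_inj (M := selfObj A E.hA) (hom_ext fun z => by
      have := hc x z
      rw [h, hc] at this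
      exact this.symm)
  · apply isSupMap_of_iSup
    intro ι x
    refine (hce _ _ fun z => ?_).symm
    have e1 : E.e (⨆ i, x i) ⊙ z = ⨆ i, E.e (x i) ⊙ z := E.ap_e_iSup x z
    rw [ap_e_iSup, h4.iSup, e1]
    simp only [hc]
  · intro x b
    refine (hce _ _ fun z => ?_).symm
    rw [← ap_bh_e, hc]
    exact E.ap_bh_e b x z
  · intro x x'
    apply E.bh_inj
    apply hom_ext
    intro z
    apply ext_right
    intro z'
    rw [← hip_e, ← h5, hc, hc]
    exact E.hip_e (M := selfObj A E.hA) x' x z z'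
  · intro v v' h
    apply E.e_inj
    apply hom_ext
    intro z
    apply h3
    apply E.sep_elt
    intro y z'
    rw [← hc, h5, h5, hip_e, hip_e]
    rw [h]

end Eqv
end SM


namespace SM
variable {B : Type u} [InvQuantale B]

theorem stage2 (hB : InvQuantale.MReg B) (V X : HObj B) (c : X.carrier → V.carrier)
    (hcs : IsSupMap c) (hca : ∀ x b, c (hact x b) = hact (c x) b)
    (hsep : ∀ v v', (∀ x, hip (c x) v = hip (c x) v') → v = v') :
    ∃ (Q : HObj B) (p1 p2 : Q.carrier → V.carrier),
    (∀ q, ∃ v x, v ≤ p2 q ∧ p1 q = v ⊔ c x) ∧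
    (∀ v1 v2 v x, v ≤ v2 → v1 = v ⊔ c x → ∃ q, p1 q = v1 ∧ p2 q = v2) ∧
    (∀ q q', p1 q = p1 q' → p2 q = p2 q' → q = q') ∧
    IsSupMap p1 ∧ IsSupMap p2 ∧
    (∀ q q', hip q q' = hip (p1 q) (p1 q') ⊔ hip (p2 q) (p2 q')) ∧
    (∀ q b, p1 (hact q b) = hact (p1 q) b) ∧ (∀ q b, p2 (hact q b) = hact (p2 q) b) := by
  obtain ⟨P, e, hp, ha⟩ := exists_prod hB V V
  have he1 : IsSupMap (fun x => (e x).1) := by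
    apply isSupMap_of_iSup
    intro ι x
    simp only [map_iSup, Prod.fst_iSup]
  have he2 : IsSupMap (fun x => (e x).2) := by
    apply isSupMap_of_iSup
    intro ι x
    simp only [map_iSup, Prod.snd_iSup]
  let S : P.carrier → Prop := fun q => ∃ v x, v ≤ (e q).2 ∧ (e q).1 = v ⊔ c x
  have hsup : ∀ T : Set P.carrier, (∀ t ∈ T, S t) → S (sSup T) := by
    intro T hT
    choose! v x h1 h2 using hT
    refine ⟨⨆ t ∈ T, v t, ⨆ t ∈ T, x t, ?_, ?_⟩
    · refine le_of_le_of_eq ?_ (he2 T).symm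
      exact iSup₂_mono h1
    · refine (he1 T).trans ?_
      rw [hcs.iSup]
      simp only [hcs.iSup]
      simp only [← iSup_sup_eq]
      exact iSup_congr fun t => iSup_congr fun ht => h2 t ht
  have hS : ∀ v1 v2 v x, v ≤ v2 → v1 = v ⊔ c x → S (e.symm (v1, v2)) := by
    intro v1 v2 v x h1 h2
    exact ⟨v, x, by simpa using h1, by simpa using h2⟩
  have hSd : ∀ v, S (e.symm (v, v)) := fun v => hS v v v ⊥ le_rfl (by simp [hcs.bot])
  have hS2 : ∀ v, S (e.symm (⊥, v)) := fun v => hS ⊥ v ⊥ ⊥ bot_le (by simp [hcs.bot])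
  have hS1 : ∀ x, S (e.symm (c x, ⊥)) := fun x => hS _ _ ⊥ x le_rfl (by simp)
  have hact' : ∀ m a, S m → S (hact m a) := by
    rintro m a ⟨v, x, h1, h2⟩
    refine ⟨hact v a, hact x a, ?_, ?_⟩
    · rw [ha]; exact hact_mono_left h1 a
    · rw [ha, hca]
      change hact (e m).1 a = _
      rw [h2, hact_sup_left]
  have hasym : ∀ v1 v2 b, e.symm (hact v1 b, hact v2 b) = hact (e.symm (v1, v2)) b := by
    intro v1 v2 b
    apply e.injective
    rw [ha]; simp
  obtain ⟨Q, val, k1, k2, k3, k4, k5, k6⟩ := exists_sub hB P S hsup hact' (by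
      rintro m ⟨v, x, h1, h2⟩
      have hm : m = e.symm (v, v) ⊔ e.symm (c x, ⊥) ⊔ e.symm (⊥, (e m).2) := by
        apply e.injective
        simp only [map_sup, OrderIso.apply_symm_apply]
        apply Prod.ext
        · simp [h2]
        · simp [h1]
      rw [hm]
      refine Gen.sup (Gen.sup ?_ ?_) ?_
      · refine ess_ind (fun v => Gen {y | ∃ p a, S p ∧ y = hact p a} (e.symm (v, v))) ?_ ?_ v
        · intro ι w hw
          rw [show e.symm (⨆ i, w i, ⨆ i, w i) = ⨆ i, e.symm (w i, w i) by
            rw [← Prod.iSup_mk, map_iSup]]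
          exact Gen.iSup hw
        · intro w b
          exact Gen.base ⟨_, b, hSd w, hasym _ _ _⟩
      · refine ess_ind (fun x => Gen {y | ∃ p a, S p ∧ y = hact p a} (e.symm (c x, ⊥))) ?_ ?_ x
        · intro ι w hw
          rw [show e.symm (c (⨆ i, w i), ⊥) = ⨆ i, e.symm (c (w i), ⊥) by
            rw [← map_iSup, Prod.iSup_mk, hcs.iSup]; simp]
          exact Gen.iSup hw
        · intro w b
          refine Gen.base ⟨_, b, hS1 w, ?_⟩
          rw [← hasym, hca]; simp
      · refine ess_ind (fun v => Gen {y | ∃ p a, S p ∧ y = hact p a} (e.symm (⊥, v))) ?_ ?_ _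
        · intro ι w hw
          rw [show e.symm (⊥, ⨆ i, w i) = ⨆ i, e.symm (⊥, w i) by
            rw [← map_iSup, Prod.iSup_mk]; simp]
          exact Gen.iSup hw
        · intro w b
          refine Gen.base ⟨_, b, hS2 w, ?_⟩
          rw [← hasym]; simp)
    (by
      intro m n hm hn h
      apply e.injective
      apply Prod.ext
      · apply hsep
        intro x
        simpa [hp] using h _ (hS1 x)
      · apply ext_right
        intro v
        simpa [hp] using h _ (hS2 v))
  refine ⟨Q, fun q => (e (val q)).1, fun q => (e (val q)).2, fun q => k1 q, ?_, ?_, ?_, ?_, ?_, ?_, ?_⟩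
  · intro v1 v2 v x h1 h2
    obtain ⟨q, hq⟩ := k2 _ (hS v1 v2 v x h1 h2)
    exact ⟨q, by simp [hq], by simp [hq]⟩
  · intro q q' h1 h2
    exact k3 (e.injective (Prod.ext h1 h2))
  · apply isSupMap_of_iSup
    intro ι x
    rw [k4.iSup]
    exact he1.iSup _
  · apply isSupMap_of_iSup
    intro ι x
    rw [k4.iSup]
    exact he2.iSup _
  · intro q q'; rw [← k5, hp]
  · intro q b; simp only [k6, ha]
  · intro q b; simp only [k6, ha]

end SM


namespace SM

theorem stageT {A : Type u} [InvQuantale A] (hA : InvQuantale.MReg A) (N J : HObj A)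
    (π : N ⟶ J) (val : J.carrier → (selfObj A hA).carrier) (hs : IsSupMap val)
    (ha : ∀ m a, val (hact m a) = hact (val m) a) :
    ∃ (T : HObj A) (tq : N.carrier → A → T.carrier),
    (∀ t, ∃ n a, t = tq n a) ∧
    (∀ n a n' a', hip (tq n a) (tq n' a') = hip n n' ⊔ star (oS (val (π ⊙ n))) * a' ⊔
      star a * oS (val (π ⊙ n')) ⊔ star a * a') := by
  obtain ⟨T, tq, h1, h2, h3, h4⟩ := exists_quot hA (N.carrier × A)
    (fun p b => (hact p.1 b, p.2 * b))
    (fun p q => hip p.1 q.1 ⊔ star (oS (val (π ⊙ p.1))) * q.2 ⊔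
      star p.2 * oS (val (π ⊙ q.1)) ⊔ star p.2 * q.2)
    (by
      intro p
      apply isSupMap_of_iSup
      intro ι x
      simp only [Prod.fst_iSup, Prod.snd_iSup, hip_iSup, ap_iSup, hs.iSup, oS_iSup,
        Quantale.mul_iSup, iSup_sup_eq])
    (by
      intro p q
      simp only [qstar_sup, star_hip, qsm, qss]
      ac_rfl)
    (by
      intro p q a
      simp only [hip_act, ap_act, ha, oS_act, qsup_mul, qmul_assoc])
    (by
      intro p
      have : Gen {x : N.carrier × A | ∃ (q : N.carrier × A) (a : A), x = (hact q.1 a, q.2 * a)} p := by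
        have e : p = (p.1, ⊥) ⊔ (⊥, p.2) := by
          apply Prod.ext <;> simp
        rw [e]
        apply Gen.sup
        · refine ess_ind (fun n => Gen {x : N.carrier × A | ∃ (q : N.carrier × A) (a : A), x = (hact q.1 a, q.2 * a)}
            (n, ⊥)) ?_ ?_ p.1
          · intro ι x hx
            rw [show ((⨆ i, x i, ⊥) : N.carrier × A) = ⨆ i, (x i, ⊥) by
              rw [Prod.iSup_mk]; simp]
            exact Gen.iSup hx
          · intro m a
            exact Gen.base ⟨(m, ⊥), a, by simp⟩
        · refine self_ess_ind hA (fun n => Gen {x : N.carrier × A | ∃ (q : N.carrier × A) (a : A), x = (hact q.1 a, q.2 * a)}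
            (⊥, n)) ?_ ?_ p.2
          · intro ι x hx
            rw [show ((⊥, ⨆ i, x i) : N.carrier × A) = ⨆ i, (⊥, x i) by
              rw [Prod.iSup_mk]; simp]
            exact Gen.iSup hx
          · intro m a
            exact Gen.base ⟨(⊥, m), a, by simp⟩
      obtain ⟨S, hS, h⟩ := this
      exact ⟨S, hS, fun r => by rw [← h]⟩)
  refine ⟨T, fun n a => tq (n, a), ?_, fun n a n' a' => h3 _ _⟩
  intro t
  obtain ⟨⟨n, a⟩, rfl⟩ := h1 t
  exact ⟨n, a, rfl⟩

namespace Eqv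
variable {A B : Type u} [InvQuantale A] [InvQuantale B] (E : Eqv A B)

theorem S1 (a : A) : Gen E.Jset (iS E.hA a) := by
  obtain ⟨J, val, c, v1, v2, vinj, vsup, vip, vact, hc, cinj, csup, cact, cip, csep⟩ := E.stage1
  obtain ⟨Q, p1, p2, q1, q2, qinj, p1s, p2s, qhip, p1a, p2a⟩ :=
    stage2 E.hB (E.fo J) E.X c csup cact csep
  have hd : ∀ v, ∃ q, p1 q = v ∧ p2 q = v := fun v => q2 v v v ⊥ le_rfl (by simp [csup.bot])
  have h0 : ∀ v, ∃ q, p1 q = ⊥ ∧ p2 q = v := fun v => q2 ⊥ v ⊥ ⊥ bot_le (by simp [csup.bot])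
  have hx0 : ∀ x, ∃ q, p1 q = c x ∧ p2 q = ⊥ := fun x => q2 _ _ ⊥ x le_rfl (by simp)
  choose dg hd1 hd2 using hd
  choose z0 hz1 hz2 using h0
  let pr2 : Q ⟶ E.fo J := mkH p2 z0 (fun q v => by rw [qhip, hz1, hz2]; simp)
  let κ : Q ⟶ E.fo J := mkH (fun q => p1 q ⊔ p2 q) dg (fun q v => by
    rw [qhip, hd1, hd2, hip_sup_left])
  have hpr2 : ∀ q, pr2 ⊙ q = p2 q := fun _ => rfl
  have hpr2s : ∀ v, hStar pr2 ⊙ v = z0 v := fun _ => ap_star_mk _ _ _ _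
  have hκs : ∀ v, hStar κ ⊙ v = dg v := fun _ => ap_star_mk _ _ _ _
  let π : E.go Q ⟶ J := E.gm pr2 ≫ E.eta J
  let χ : E.go Q ⟶ J := E.gm κ ≫ E.eta J
  have hπs : hStar π ≫ π = 𝟙 J := by
    have : hStar pr2 ≫ pr2 = 𝟙 _ := hom_ext fun v => by simp [hpr2s, hpr2, hz2]
    calc hStar π ≫ π = hStar (E.eta J) ≫ (hStar (E.gm pr2) ≫ E.gm pr2) ≫ E.eta J := by
          simp only [π, hStar_comp, Category.assoc]
      _ = 𝟙 J := by rw [← gm_star, ← gm_comp, this, gm_id, Category.id_comp, eta2]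
  have hππ : ∀ n, hStar π ⊙ π ⊙ n ≤ n := by
    intro n
    have h1 : π ≫ hStar π = E.gm (pr2 ≫ hStar pr2) := by
      calc π ≫ hStar π = E.gm pr2 ≫ (E.eta J ≫ hStar (E.eta J)) ≫ hStar (E.gm pr2) := by
            simp only [π, hStar_comp, Category.assoc]
        _ = _ := by rw [eta1, Category.id_comp, ← gm_star, ← gm_comp]
    have h2 : hS (fun b : ULift.{u} Bool => if b.down then pr2 ≫ hStar pr2 else 𝟙 Q) = 𝟙 Q := by
      apply hom_ext
      intro q
      rw [ap_hS]
      apply le_antisymm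
      · apply iSup_le
        rintro ⟨b⟩
        cases b
        · simp
        · simp only [ap_comp, hpr2s, hpr2, if_true, ap_id]
          have : z0 (p2 q) ⊔ q = q := by
            apply qinj
            · rw [p1s.sup, hz1]; simp
            · rw [p2s.sup, hz2]; simp
          exact sup_eq_right.1 this
      · exact le_iSup_of_le ⟨false⟩ (by simp)
    have h3 : hS (fun b : ULift.{u} Bool => E.gm (if b.down then pr2 ≫ hStar pr2 else 𝟙 Q)) = 𝟙 _ := by
      rw [← gm_hS, h2, gm_id]
    have h4 := congrArg (fun k => k ⊙ n) h3
    simp only [ap_hS, ap_id] at h4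
    calc hStar π ⊙ π ⊙ n = E.gm (pr2 ≫ hStar pr2) ⊙ n := by rw [← h1]; rfl
      _ ≤ _ := le_iSup (fun b : ULift.{u} Bool =>
            E.gm (if b.down then pr2 ≫ hStar pr2 else 𝟙 Q) ⊙ n) ⟨true⟩
      _ = n := h4
  have hgπ : ∀ q z, π ⊙ E.g q ⊙ z = E.e (p2 q) ⊙ z := by
    intro q z
    change E.eta J ⊙ E.gm pr2 ⊙ E.g q ⊙ z = _
    rw [ap_g_gm]; rfl
  have hχ : ∀ v z, hStar χ ⊙ E.e v ⊙ z = E.g (dg v) ⊙ z := by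
    intro v z
    have : E.e v ≫ hStar χ = E.g (dg v) := by
      calc E.e v ≫ hStar χ = E.g v ≫ (E.eta J ≫ hStar (E.eta J)) ≫ hStar (E.gm κ) := by
            simp only [χ, e, hStar_comp, Category.assoc]
        _ = _ := by rw [eta1, Category.id_comp, ← gm_star, g_gm, hκs]
    rw [← this]; rfl
  obtain ⟨T, tq, tsurj, tip⟩ := stageT E.hA (E.go Q) J π val vsup vact
  have text : ∀ n a n' a', (∀ m b, hip (tq m b) (tq n a) = hip (tq m b) (tq n' a')) →
      tq n a = tq n' a' := by
    intro n a n' a' h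
    apply ext_right
    intro t
    obtain ⟨m, b, rfl⟩ := tsurj t
    exact h m b
  have vb : val ⊥ = ⊥ := vsup.bot
  choose tn ta htn using tsurj
  let ρ : selfObj A E.hA ⟶ T := mkH (fun a => tq ⊥ (oS a))
    (fun t => iS E.hA (oS (val (π ⊙ tn t)) ⊔ ta t)) (fun a t => by
      conv_lhs => rw [htn t]
      rw [tip]
      simp [vb, qmul_sup])
  have hρs : ∀ n a, hStar ρ ⊙ tq n a = iS E.hA (oS (val (π ⊙ n)) ⊔ a) := by
    intro n a
    apply ext_right
    intro b
    rw [← adj]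
    change hip (tq ⊥ (oS b)) _ = _
    rw [tip]
    simp [vb, qmul_sup]
  have tbot : ∀ n n', hip (tq n ⊥) (tq n' ⊥) = hip n n' := by
    intro n n'; rw [tip]; simp
  have tinj : ∀ n n', tq n ⊥ = tq n' ⊥ → n = n' := by
    intro n n' h
    apply ext_right
    intro m
    rw [← tbot, h, tbot]
  have key1 : ∀ t, Gen E.Jset (hStar ρ ⊙ t) → ∃ n, t = tq n ⊥ := by
    intro t ht
    obtain ⟨j, hj⟩ := v2 _ ht
    have htn' := htn t
    refine ⟨tn t ⊔ hStar π ⊙ j, ?_⟩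
    conv_lhs => rw [htn']
    apply text
    intro m b
    rw [htn', hρs] at hj
    have hj' : oS (val j) = oS (val (π ⊙ tn t)) ⊔ ta t := congrArg oS hj
    have hle : star (oS (val (π ⊙ m))) * oS (val (π ⊙ tn t)) ≤ hip m (tn t) := by
      change hip (val (π ⊙ m)) (val (π ⊙ tn t)) ≤ _
      rw [vip, adj]
      exact hip_mono (hππ _)
    have hm : hip m (hStar π ⊙ j) = star (oS (val (π ⊙ m))) * oS (val j) := by
      rw [← adj, ← vip]; rfl
    have hπj : π ⊙ hStar π ⊙ j = j := congrArg (fun k => k ⊙ j) hπs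
    rw [tip, tip, hip_sup, hm, ap_sup, hπj, vsup.sup, oS_sup, hj']
    simp only [qmul_sup, qmul_bot, sup_bot_eq]
    apply le_antisymm
    · refine sup_le (sup_le (sup_le ?_ ?_) ?_) ?_
      · exact le_sup_of_le_left le_sup_left
      · exact le_sup_of_le_left (le_sup_of_le_right le_sup_right)
      · exact le_sup_of_le_right le_sup_left
      · exact le_sup_of_le_right (le_sup_of_le_right le_sup_right)
    · refine sup_le (sup_le ?_ (sup_le ?_ ?_)) (sup_le ?_ (sup_le ?_ ?_))
      · exact le_sup_of_le_left (le_sup_of_le_left le_sup_left)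
      · exact le_sup_of_le_left (le_sup_of_le_left (le_sup_of_le_left hle))
      · exact le_sup_of_le_left (le_sup_of_le_left le_sup_right)
      · exact le_sup_of_le_left le_sup_right
      · exact le_sup_of_le_left le_sup_right
      · exact le_sup_right
  have tsup : ∀ (ι : Type u) (n : ι → (E.go Q).carrier), tq (⨆ i, n i) ⊥ = ⨆ i, tq (n i) ⊥ := by
    intro ι n
    apply ext_right
    intro t
    rw [htn t, hip_iSup]
    simp only [tip, hip_iSup, ap_iSup, vsup.iSup, oS_iSup, Quantale.mul_iSup, qmul_bot, sup_bot_eq,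
      iSup_sup_eq]
  have key2 : ∀ y : (E.fo T).carrier, ∃ q, ∀ z, E.e y ⊙ z = tq (E.g q ⊙ z) ⊥ := by
    refine ess_ind _ ?_ ?_
    · intro ι y hy
      choose q hq using hy
      refine ⟨⨆ i, q i, fun z => ?_⟩
      rw [ap_e_iSup, ap_g_iSup, tsup]
      simp only [hq]
    · intro y b
      have : ∀ z, ∃ n, E.e y ⊙ z = tq n ⊥ := fun z => key1 _ (by
        rw [ap_e_comp]; exact Gen.base ⟨_, _, rfl⟩)
      choose φ hφ using this
      let w' : E.Z ⟶ E.go Q := mkH φ (fun n => hStar (E.e y) ⊙ tq n ⊥) (fun z n => by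
        rw [← tbot, ← hφ, adj])
      obtain ⟨q, hq⟩ := E.small_g w' b
      refine ⟨q, fun z => ?_⟩
      rw [← hq, ← ap_bh_e, hφ]
      rfl
  choose qy hqy using key2
  have key3 : ∀ y, p2 (qy y) = c (E.fm (hStar ρ) ⊙ y) := by
    intro y
    apply E.e_inj
    apply hom_ext
    intro z
    apply vinj
    rw [hc]
    have := E.ap_e_comp y (hStar ρ) z
    rw [hqy, hρs, hgπ] at this
    rw [sup_bot_eq] at this
    exact this
  have key4 : ∀ y, ∃ x, c x = p1 (qy y) ⊔ p2 (qy y) := by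
    intro y
    obtain ⟨v, x, h1, h2⟩ := q1 (qy y)
    refine ⟨x ⊔ E.fm (hStar ρ) ⊙ y, ?_⟩
    have e1 : c (x ⊔ E.fm (hStar ρ) ⊙ y) = c x ⊔ c (E.fm (hStar ρ) ⊙ y) := csup.sup _ _
    rw [e1, ← key3, h2, sup_comm v, sup_assoc, sup_eq_right.2 h1]
  choose ky hky using key4
  have key6 : ∀ s : E.X.carrier → Q.carrier, IsSupMap s → (∀ x b, s (hact x b) = hact (s x) b) →
      (∀ x, ∃ x', p2 (s x) = c x') → ∀ x, ∃ y, ∀ z, E.e y ⊙ z = tq (E.g (s x) ⊙ z) ⊥ := by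
    intro s hs hsa hs2
    refine ess_ind _ ?_ ?_
    · intro ι x hx
      choose y hy using hx
      refine ⟨⨆ i, y i, fun z => ?_⟩
      rw [ap_e_iSup, hs.iSup, ap_g_iSup, tsup]
      simp only [hy]
    · intro x b
      obtain ⟨x', hx'⟩ := hs2 x
      let m : E.Z ⟶ T := mkH (fun z => tq (E.g (s x) ⊙ z) ⊥)
        (fun t => hStar (E.g (s x)) ⊙ tn t ⊔ hStar (E.e x') ⊙ iS E.hA (ta t)) (fun z t => by
          conv_lhs => rw [htn t]
          rw [tip, hip_sup, ← adj, hgπ, hx', hc]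
          have := adj (E.e x') z (iS E.hA (ta t))
          rw [← this]
          simp)
      obtain ⟨y, hy⟩ := E.small_e m b
      refine ⟨y, fun z => ?_⟩
      rw [← hy, hsa, ← ap_bh_g]
      rfl
  choose s1 hs11 hs12 using hx0
  have key7 := key6 (fun x => dg (c x))
    (by
      intro S
      apply qinj
      · simp only [p1s.iSup, hd1]; exact csup S
      · simp only [p2s.iSup, hd2]; exact csup S)
    (by
      intro x b
      apply qinj
      · rw [hd1, p1a, hd1]; exact cact _ _
      · rw [hd2, p2a, hd2]; exact cact _ _)
    (fun x => ⟨x, hd2 _⟩)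
  have key8 := key6 s1
    (by
      intro S
      apply qinj
      · simp only [p1s.iSup, hs11]; exact csup S
      · simp only [p2s.iSup, hs12]; simp)
    (by
      intro x b
      apply qinj
      · rw [hs11, p1a, hs11]; exact cact _ _
      · rw [hs12, p2a, hs12]; simp)
    (fun x => ⟨⊥, by rw [hs12]; exact csup.bot.symm⟩)
  choose yx hyx using key7
  choose y0 hy0 using key8
  have qq : ∀ y q, (∀ z, E.e y ⊙ z = tq (E.g q ⊙ z) ⊥) → qy y = q := by
    intro y q h
    apply E.g_inj
    apply hom_ext
    intro z
    apply tinj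
    rw [← hqy, h]
  let k : E.fo T ⟶ E.X := mkH ky yx (fun y x => by
    apply E.bh_inj
    apply hom_ext
    intro z
    apply ext_right
    intro z'
    rw [← E.hip_e (M := T) (yx x) y z z', hqy, hyx, tbot, hip_g, qhip, hd1, hd2, ← hip_sup_left, ← hky, cip])
  obtain ⟨σ, hσ⟩ := E.fm_full k
  have hσe : ∀ y z, σ ⊙ E.e y ⊙ z = E.e (M := selfObj A E.hA) (ky y) ⊙ z := by
    intro y z
    rw [ap_e_comp, hσ]; rfl
  have kyx : ∀ x, ky (yx x) = x := by
    intro x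
    apply cinj
    rw [hky, qq _ _ (hyx x), hd1, hd2, sup_idem]
  have ky0 : ∀ x, ky (y0 x) = x := by
    intro x
    apply cinj
    rw [hky, qq _ _ (hy0 x), hs11, hs12, sup_bot_eq]
  obtain ⟨n, a', hna⟩ : ∃ n a', hStar σ ⊙ iS E.hA a = tq n a' := ⟨_, _, htn _⟩
  have f1 : ∀ x z, hip (E.g (dg (c x)) ⊙ z) n ⊔ star (oS (E.e x ⊙ z)) * a' =
      hip (E.e x ⊙ z) (iS E.hA a) := by
    intro x z
    have h1 := adj σ (E.e (yx x) ⊙ z) (iS E.hA a)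
    rw [hσe, kyx, hna, hyx, tip, hgπ, hd2, hc] at h1
    rw [h1]; simp
  have f2 : ∀ x z, hip (E.g (s1 x) ⊙ z) n = hip (E.e x ⊙ z) (iS E.hA a) := by
    intro x z
    have h1 := adj σ (E.e (y0 x) ⊙ z) (iS E.hA a)
    have e0 : E.e (⊥ : (E.fo J).carrier) ⊙ z = ⊥ := by
      rw [← iSup_of_empty (fun _ : PEmpty.{u+1} => (⊥ : (E.fo J).carrier)), ap_e_iSup]; simp
    rw [hσe, ky0, hna, hy0, tip, hgπ, hs12, e0, vb] at h1
    rw [h1]; simp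
  have gmono : ∀ (q q' : Q.carrier) z, q ≤ q' → E.g q ⊙ z ≤ E.g q' ⊙ z := by
    intro q q' z h
    rw [← sup_eq_right.2 h, sup_eq_iSup]
    have h1 := E.ap_g_iSup (fun b : ULift.{u} Bool => cond b.down q q') z
    have h2 : (⨆ b : ULift.{u} Bool, cond b.down q q') = ⨆ b : Bool, cond b q q' :=
      Equiv.ulift.iSup_comp (g := fun b => cond b q q')
    rw [h2] at h1
    rw [h1]
    exact le_iSup (fun b : ULift.{u} Bool => E.g (cond b.down q q') ⊙ z) ⟨true⟩
  have f3 : ∀ x z, hip (E.g (dg (c x)) ⊙ z) n = hip (E.e x ⊙ z) (iS E.hA a) := by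
    intro x z
    apply le_antisymm
    · rw [← f1]; exact le_sup_left
    · rw [← f2]
      apply hip_mono_left
      apply gmono
      apply sup_eq_right.1
      apply qinj
      · rw [p1s.sup, hs11, hd1, sup_idem]
      · rw [p2s.sup, hs12, hd2, bot_sup_eq]
  have f4 : iS E.hA a = val (χ ⊙ n) := by
    apply E.sep_elt
    intro x z
    rw [← f3, ← hχ, ← adj']
    rw [← vip, hc]
  rw [f4]
  exact v1 _
end Eqv
end SM


namespace SM
namespace Eqv
variable {A B : Type u} [InvQuantale A] [InvQuantale B] (E : Eqv A B)

theorem ah_mul (a b : A) (x : E.X.carrier) : E.ah (a * b) ⊙ x = E.ah a ⊙ E.ah b ⊙ x :=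
  (E.swap.ap_bh_bh b a x).symm
theorem ah_iSup {ι : Type u} (y : ι → A) (z : E.X.carrier) :
    E.ah (⨆ i, y i) ⊙ z = ⨆ i, E.ah (y i) ⊙ z := E.swap.ap_bh_iSup y z
theorem ah_uniq {a b : A} (h : ∀ z, E.ah a ⊙ z = E.ah b ⊙ z) : a = b :=
  E.swap.bh_inj (hom_ext h)
theorem ah_star (a : A) : hStar (E.ah a) = E.ah (star a) := E.swap.bh_star a

theorem beta (b : B) : Gen {y | ∃ (h : E.X ⟶ selfObj B E.hB) (a : A) (x : E.X.carrier),
    y = h ⊙ E.ah a ⊙ x} (iS E.hB b) := by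
  refine (E.swap.S1 b).mono ?_
  rintro _ ⟨z, x, rfl⟩
  refine ess_ind (M := E.Z) (fun z => Gen _ (E.swap.e (M := selfObj B E.hB) z ⊙ x)) ?_ ?_ z
  · intro ι y hy
    have h1 := E.swap.ap_e_iSup (M := selfObj B E.hB) y x
    exact h1 ▸ Gen.iSup hy
  · intro m a
    apply Gen.base
    exact ⟨E.swap.e (M := selfObj B E.hB) m, a, x,
      (E.swap.ap_bh_e (M := selfObj B E.hB) a m x).symm⟩

theorem genP (Y : HObj A) (p : (E.fo Y).carrier) :
    Gen {q | ∃ (y : Y.carrier) (x : E.X.carrier), q = E.fm (elt E.hA y) ⊙ x} p := by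
  refine ess_ind (fun p => Gen _ p) (fun _ _ => Gen.iSup) ?_ p
  intro p b
  have h0 : ∀ y : (selfObj B E.hB).carrier, Gen {y | ∃ (h : E.X ⟶ selfObj B E.hB) (a : A)
      (x : E.X.carrier), y = h ⊙ E.ah a ⊙ x} y → Gen {q | ∃ (y : Y.carrier) (x : E.X.carrier),
        q = E.fm (elt E.hA y) ⊙ x} (elt E.hB p ⊙ y) := by
    intro y hy
    refine hy.ind (fun y => Gen _ (elt E.hB p ⊙ y)) ?_ ?_
    · intro ι x hx
      rw [ap_iSup]; exact Gen.iSup hx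
    · rintro _ ⟨h, a, x, rfl⟩
      obtain ⟨k, hk⟩ := E.fm_full (h ≫ elt E.hB p)
      apply Gen.base
      refine ⟨k ⊙ iS E.hA a, x, ?_⟩
      rw [← ap_comp, ← hk, ← lmul_comp, fm_comp]
      rfl
  exact h0 _ (E.beta b)

theorem less' (p : E.X.carrier) :
    Gen {q | ∃ (a : A) (x : E.X.carrier), q = E.ah a ⊙ x} p := by
  refine (E.genP (selfObj A E.hA) p).mono ?_
  rintro _ ⟨y, x, rfl⟩
  exact Gen.base ⟨oS y, x, rfl⟩

theorem ex_lip (x y : E.X.carrier) : ∃ a : A, ∀ z, E.ah a ⊙ z = hact x (hip y z) := by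
  refine (E.less' x).ind (fun x => ∃ a : A, ∀ z, E.ah a ⊙ z = hact x (hip y z)) ?_ ?_
  · intro ι x hx
    choose a ha using hx
    refine ⟨⨆ i, a i, fun z => ?_⟩
    rw [ah_iSup, iSup_hact]
    simp only [ha]
  · rintro _ ⟨a, x, rfl⟩
    obtain ⟨k, hk⟩ := E.fm_full (hStar (elt E.hB y) ≫ elt E.hB x)
    have h1 : k ≫ lmulHom A E.hA a =
        lmulHom A E.hA (star (oS (hStar k ⊙ iS E.hA (star a)))) := by
      apply star_inj
      rw [hStar_comp, star_lmul, star_lmul, qss, lmul_comp]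
      rfl
    refine ⟨star (oS (hStar k ⊙ iS E.hA (star a))), fun z => ?_⟩
    rw [ah, ← h1, fm_comp, hk]
    simp only [ap_comp, ap_star_elt, ap_elt, oS_iS, ap_act]
    rfl

/-- the left inner product -/
noncomputable def lip (x y : E.X.carrier) : A := (E.ex_lip x y).choose
theorem ah_lip (x y z : E.X.carrier) : E.ah (E.lip x y) ⊙ z = hact x (hip y z) :=
  (E.ex_lip x y).choose_spec z
theorem eq_lip {a : A} {x y : E.X.carrier} (h : ∀ z, E.ah a ⊙ z = hact x (hip y z)) :
    a = E.lip x y := E.ah_uniq fun z => by rw [h, ah_lip]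

theorem rfull' (b : B) : Gen {c : B | ∃ x y : E.X.carrier, c = hip x y} b := by
  refine self_ess_ind E.hB (fun b => Gen _ b) (fun _ _ => Gen.iSup) ?_ b
  intro b1 b2
  have h0 : ∀ y : (selfObj B E.hB).carrier, Gen {y | ∃ (h : E.X ⟶ selfObj B E.hB) (a : A)
      (x : E.X.carrier), y = h ⊙ E.ah a ⊙ x} y →
      Gen {c : B | ∃ x y : E.X.carrier, c = hip x y} (hip (iS E.hB (star b1)) y) := by
    intro y hy
    refine hy.ind (fun y => Gen _ (hip (iS E.hB (star b1)) y)) ?_ ?_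
    · intro ι x hx
      rw [hip_iSup]; exact Gen.iSup hx
    · rintro _ ⟨h, a, x, rfl⟩
      exact Gen.base ⟨_, _, adj' _ _ _⟩
  have h1 := h0 _ (E.beta b2)
  rw [self_hip, oS_iS, qss] at h1
  exact h1

theorem lfull' (a : A) : Gen {c : A | ∃ x y : E.X.carrier, c = E.lip x y} a := by
  have h0 : ∀ y : (selfObj A E.hA).carrier, Gen E.Jset y →
      Gen {c : A | ∃ x y : E.X.carrier, c = E.lip x y} (oS y) := by
    intro y hy
    refine hy.ind (fun y => Gen _ (oS y)) ?_ ?_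
    · intro ι x hx
      rw [oS_iSup]; exact Gen.iSup hx
    · rintro _ ⟨x, z, rfl⟩
      refine ess_ind (M := E.X) (fun x => Gen _ (oS (E.e (M := selfObj A E.hA) x ⊙ z))) ?_ ?_ x
      · intro ι y hy
        have h1 := E.ap_e_iSup (M := selfObj A E.hA) y z
        exact h1 ▸ Gen.iSup hy
      intro x b
      refine self_ess_ind E.hB
        (fun b => Gen _ (oS (E.e (M := selfObj A E.hA) (hact x b) ⊙ z))) ?_ ?_ b
      · intro ι y hy
        have h1 := E.ap_e_iSup (M := selfObj A E.hA) (fun i => hact x (y i)) z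
        rw [hact_iSup]
        exact h1 ▸ Gen.iSup hy
      intro b1 b2
      apply Gen.base
      let p : E.X ⟶ selfObj B E.hB := E.fm (elt E.hA z) ≫ E.zeta _
      let φ : selfObj B E.hB ⟶ E.X := hStar (E.zeta _) ≫ E.fm (E.e (M := selfObj A E.hA) x)
      refine ⟨φ ⊙ iS E.hB b1, hStar p ⊙ iS E.hB (star b2), E.eq_lip fun w => ?_⟩
      have h1 : lmulHom A E.hA (oS (E.e (M := selfObj A E.hA) (hact x (b1 * b2)) ⊙ z)) =
          elt E.hA z ≫ E.bh (b1 * b2) ≫ E.e (M := selfObj A E.hA) x := by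
        rw [← elt_iS, iS_oS, ← elt_comp, ← bh_e]
      have h2 : E.fm (E.bh (b1 * b2)) = E.zeta _ ≫ lmulHom B E.hB (b1 * b2) ≫ hStar (E.zeta _) := by
        rw [← Category.assoc, ← zeta_nat, Category.assoc, zeta1, Category.comp_id]; rfl
      rw [ah, h1, fm_comp, fm_comp, h2, ← lmul_lmul]
      have h3 : ∀ c : (selfObj B E.hB).carrier,
          φ ⊙ lmulHom B E.hB b1 ⊙ c = hact (φ ⊙ iS E.hB b1) (oS c) := by
        intro c
        rw [← ap_comp, lmul_comp]; rfl
      rw [← adj']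
      change φ ⊙ lmulHom B E.hB b1 ⊙ lmulHom B E.hB b2 ⊙ p ⊙ w = _
      rw [h3, self_hip, ap_lmul]
      simp
  exact h0 _ (E.S1 a)

theorem isImprim : IsImprim A B E.X.carrier (fun a x => E.ah a ⊙ x) E.lip where
  bimod := {
    lact_mul := E.ah_mul
    sSup_lact := fun S m => isSupMap_of_iSup (f := fun a => E.ah a ⊙ m)
      (fun ι x => E.ah_iSup x m) S
    lact_sSup := fun a S => isSupMap_of_iSup (f := fun m => E.ah a ⊙ m)
      (fun ι x => ap_iSup _ x) S
    lact_act := fun a x b => ap_act _ x b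
    ip_lact := fun a x y => by
      have := adj (E.ah a) x y
      rw [ah_star] at this
      exact this }
  lip_lact a x y := E.eq_lip fun z => by rw [ah_mul, ah_lip, ap_act]
  sSup_lip S y := isSupMap_of_iSup (f := fun x => E.lip x y)
      (fun ι x => (E.eq_lip fun z => by
        rw [ah_iSup, iSup_hact]; simp only [ah_lip]).symm) S
  lip_sSup x S := isSupMap_of_iSup (f := fun y => E.lip x y)
      (fun ι y => (E.eq_lip fun z => by
        rw [ah_iSup, hip_iSup_left, hact_iSup]; simp only [ah_lip]).symm) S
  star_lip x y := E.eq_lip fun z => by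
    rw [← ah_star]
    apply ext_right
    intro p
    rw [← adj, ah_lip]
    simp
  lip_sep x y h := by
    apply ext_act
    intro b
    refine (E.rfull' b).ind (fun b => hact x b = hact y b) ?_ ?_
    · intro ι b hb
      simp only [hact_iSup, hb]
    · rintro _ ⟨z, w, rfl⟩
      rw [← ah_lip, h, ah_lip]
  rfull b := (E.rfull' b).eq
  lfull a := (E.lfull' a).eq
  ress := E.X.ess
  rsep := E.X.sep
  less p := (E.less' p).eq
  lsep m n h := by
    apply ext_right
    intro p
    refine (E.less' p).ind (fun p => hip p m = hip p n) ?_ ?_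
    · intro ι b hb
      simp only [hip_iSup_left, hb]
    · rintro _ ⟨a, x, rfl⟩
      rw [adj, adj, ah_star]
      exact congrArg _ (h _)
  imp1 x y z := E.ah_lip x y z
  imp2 x y b := E.eq_lip fun z => by
    rw [ah_lip]
    change hact (hact x b) _ = hact x (hip (hact y _) z)
    rw [hip_act_left, qss, hact_mul]

theorem tens (Y : HObj A) : IsInteriorTensor A B (fun a x => E.ah a ⊙ x)
    (fun (y : Y.carrier) (x : E.X.carrier) => E.fm (elt E.hA y) ⊙ x) where
  ip_t x₁ x₂ y₁ y₂ := by
    change hip _ _ = hip _ _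
    rw [adj, ← fm_star, ← ap_comp, ← fm_comp, elt_star]
    rfl
  sSup_t S y := isSupMap_of_iSup (f := fun x => E.fm (elt E.hA x) ⊙ y)
    (fun ι x => by rw [elt_iSup, fm_hS, ap_hS]) S
  t_sSup x S := isSupMap_of_iSup (f := fun y => E.fm (elt E.hA x) ⊙ y)
    (fun ι x => ap_iSup _ _) S
  gen p := (E.genP Y p).eq

end Eqv
end SM


namespace SM

/-- a right Hilbert bimodule, m-regular on the right -/
structure Bim (A B : Type u) [InvQuantale A] [InvQuantale B] where
  obj : HObj B
  l : A → (obj ⟶ obj)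
  l_star : ∀ a, hStar (l a) = l (star a)
  l_iSup : ∀ {ι : Type u} (a : ι → A) (x : obj.carrier), l (⨆ i, a i) ⊙ x = ⨆ i, l (a i) ⊙ x

section
variable {A B : Type u} [InvQuantale A] [InvQuantale B]

theorem exists_tens (hB : InvQuantale.MReg B) (W : Bim A B) (Y : HObj A) :
    ∃ (T : HObj B) (t : Y.carrier → W.obj.carrier → T.carrier),
      (∀ y w y' w', hip (t y w) (t y' w') = hip w (W.l (hip y y') ⊙ w')) ∧
      ∀ m, Gen (Set.range fun p : Y.carrier × W.obj.carrier => t p.1 p.2) m := by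
  let ip : Set (Y.carrier × W.obj.carrier) → Set (Y.carrier × W.obj.carrier) → B :=
    fun S S' => ⨆ p : S, ⨆ q : S', hip p.1.2 (W.l (hip p.1.1 q.1.1) ⊙ q.1.2)
  have hmem : ∀ (S S') (p q), p ∈ S → q ∈ S' →
      hip p.2 (W.l (hip p.1 q.1) ⊙ q.2) ≤ ip S S' := by
    intro S S' p q hp hq
    exact le_iSup_of_le (⟨p, hp⟩ : S) (le_iSup_of_le (⟨q, hq⟩ : S') le_rfl)
  have hle : ∀ (S S') (c), (∀ p q, p ∈ S → q ∈ S' →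
      hip p.2 (W.l (hip p.1 q.1) ⊙ q.2) ≤ c) → ip S S' ≤ c := by
    intro S S' c h
    exact iSup_le fun p => iSup_le fun q => h _ _ p.2 q.2
  have hmono : ∀ S S' S'', S' ⊆ S'' → ip S S' ≤ ip S S'' := by
    intro S S' S'' h
    exact hle _ _ _ fun p q hp hq => hmem _ _ _ _ hp (h hq)
  have hsup : ∀ p, IsSupMap (ip p) := by
    intro S 𝒮
    apply le_antisymm
    · apply hle
      rintro p q hp ⟨S', hS', hq⟩
      exact le_trans (hmem _ _ _ _ hp hq) (le_iSup₂_of_le S' hS' le_rfl)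
    · refine iSup₂_le fun S' hS' => hmono _ _ _ ?_
      exact Set.subset_sUnion_of_mem hS'
  have hsing : ∀ p q, ip {p} {q} = hip p.2 (W.l (hip p.1 q.1) ⊙ q.2) := by
    intro p q
    apply le_antisymm
    · apply hle
      rintro _ _ rfl rfl
      exact le_rfl
    · exact hmem _ _ _ _ rfl rfl
  obtain ⟨T, tq, ts, tsup, tip, tact⟩ := exists_quot hB (Set (Y.carrier × W.obj.carrier))
    (fun S b => (fun p => (p.1, hact p.2 b)) '' S) ip hsup
    (by
      intro S S'
      simp only [ip, Quantale.star_iSup]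
      rw [iSup_comm]
      refine iSup_congr fun q => iSup_congr fun p => ?_
      rw [star_hip, adj, W.l_star, star_hip])
    (by
      intro S S' b
      apply le_antisymm
      · apply hle
        rintro p _ hp ⟨q, hq, rfl⟩
        simp only [ap_act, hip_act]
        rw [← sup_eq_right.2 (hmem _ _ _ _ hp hq), qsup_mul]
        exact le_sup_left
      · simp only [ip, Quantale.iSup_mul]
        refine iSup_le fun p => iSup_le fun q => ?_
        rw [hip_mul, ← ap_act]
        exact hmem S _ p.1 (q.1.1, hact q.1.2 b) p.2 ⟨q.1, q.2, rfl⟩)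
    (by
      intro P
      refine ⟨{x | (∃ q a, x = (fun p : Y.carrier × W.obj.carrier => (p.1, hact p.2 a)) '' q) ∧
        ∀ r, ip r x ≤ ip r P}, fun x hx => hx.1, fun r => ?_⟩
      rw [hsup]
      apply le_antisymm
      · apply hle
        rintro p ⟨y, w⟩ hp hq
        simp only
        have h1 := (hess W.obj w).eq
        rw [sSup_eq_iSup] at h1
        rw [h1]
        simp only [ap_iSup, hip_iSup]
        refine iSup₂_le ?_
        rintro _ ⟨⟨w', b, rfl⟩, hw⟩
        refine le_trans ?_ (le_iSup₂_of_le {(y, hact w' b)} ?_ le_rfl)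
        · exact hmem _ _ _ (y, hact w' b) hp rfl
        · refine ⟨⟨{(y, w')}, b, by simp⟩, fun r => ?_⟩
          apply hle
          rintro p _ hp rfl
          refine le_trans ?_ (hmem _ _ _ _ hp hq)
          exact hip_mono (ap_mono _ hw)
      · exact iSup₂_le fun x hx => hx.2 r)
  refine ⟨T, fun y w => tq {(y, w)}, ?_, ?_⟩
  · intro y w y' w'
    rw [tip, hsing]
  · intro m
    obtain ⟨S, rfl⟩ := ts m
    have : S = sSup ((fun p => {p}) '' S) := by
      ext p; simp
    rw [this, tsup, iSup_image]
    refine Gen.iSup fun p => Gen.iSup fun _ => Gen.base ⟨p, rfl⟩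

variable (hB : InvQuantale.MReg B) (W : Bim A B)

/-- tensor object -/
noncomputable def tO (Y : HObj A) : HObj B := (exists_tens hB W Y).choose
/-- elementary tensors -/
noncomputable def tt {Y : HObj A} : Y.carrier → W.obj.carrier → (tO hB W Y).carrier :=
  (exists_tens hB W Y).choose_spec.choose
theorem tt_ip {Y : HObj A} (y y' : Y.carrier) (w w' : W.obj.carrier) :
    hip (tt hB W y w) (tt hB W y' w') = hip w (W.l (hip y y') ⊙ w') :=
  (exists_tens hB W Y).choose_spec.choose_spec.1 y w y' w'
theorem tt_gen (Y : HObj A) : ∀ m,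
    Gen (Set.range fun p : Y.carrier × W.obj.carrier => tt hB W p.1 p.2) m :=
  (exists_tens hB W Y).choose_spec.choose_spec.2

theorem tt_iSup {Y : HObj A} {ι : Type u} (y : ι → Y.carrier) (w : W.obj.carrier) :
    tt hB W (⨆ i, y i) w = ⨆ i, tt hB W (y i) w :=
  ext_gen (tt_gen hB W Y) fun p => by
    simp only [hip_iSup, tt_ip, W.l_iSup]
theorem tt_iSup_right {Y : HObj A} {ι : Type u} (y : Y.carrier) (w : ι → W.obj.carrier) :
    tt hB W y (⨆ i, w i) = ⨆ i, tt hB W y (w i) :=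
  ext_gen (tt_gen hB W Y) fun p => by
    simp only [hip_iSup, tt_ip, ap_iSup]

theorem ex_tm {Y Y' : HObj A} (f : Y ⟶ Y') : ∃ k : tO hB W Y ⟶ tO hB W Y',
    (∀ p : Y.carrier × W.obj.carrier, k ⊙ tt hB W p.1 p.2 = tt hB W (f ⊙ p.1) p.2) ∧
    ∀ p : Y'.carrier × W.obj.carrier,
      hStar k ⊙ tt hB W p.1 p.2 = tt hB W (hStar f ⊙ p.1) p.2 :=
  lemA (tt_gen hB W Y) (tt_gen hB W Y') _ _ fun i j => by
    simp only [tt_ip, adj]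

/-- tensor on morphisms -/
noncomputable def tm {Y Y' : HObj A} (f : Y ⟶ Y') : tO hB W Y ⟶ tO hB W Y' := (ex_tm hB W f).choose
@[simp] theorem tm_tt {Y Y' : HObj A} (f : Y ⟶ Y') (y : Y.carrier) (w : W.obj.carrier) :
    tm hB W f ⊙ tt hB W y w = tt hB W (f ⊙ y) w := (ex_tm hB W f).choose_spec.1 (y, w)
@[simp] theorem tm_star_tt {Y Y' : HObj A} (f : Y ⟶ Y') (y : Y'.carrier) (w : W.obj.carrier) :
    hStar (tm hB W f) ⊙ tt hB W y w = tt hB W (hStar f ⊙ y) w :=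
  (ex_tm hB W f).choose_spec.2 (y, w)

/-- the tensor functor -/
noncomputable def TF : StarFunctor A B where
  toFunctor :=
    { obj := tO hB W
      map := tm hB W
      map_id := fun Y => hom_ext_gen (tt_gen hB W Y) fun p => by simp
      map_comp := fun f g => hom_ext_gen (tt_gen hB W _) fun p => by simp }
  map_star f := hom_ext_gen (tt_gen hB W _) fun p => by
    rw [tm_star_tt]; exact tm_tt _ _ _ _ _
  map_hSup {M N} S := hom_ext_gen (tt_gen hB W _) fun p => by
    have h1 : hSup S = hS (fun f : S => f.1) := by rw [hS, Subtype.range_coe]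
    have h2 : hSup (tm hB W '' S) = hS (fun f : S => tm hB W f.1) := by
      rw [hS, Set.image_eq_range]
    change tm hB W (hSup S) ⊙ _ = hSup (tm hB W '' S) ⊙ _
    rw [h2, h1, tm_tt, ap_hS, ap_hS, tt_iSup]
    simp only [tm_tt]

theorem exists_unit (hA : InvQuantale.MReg A) (hB : InvQuantale.MReg B) (W : Bim A B) (V : Bim B A)
    (ρ : W.obj.carrier → V.obj.carrier → A)
    (h : ∀ w1 v1 w2 v2 a, hip v1 (V.l (hip w1 (W.l a ⊙ w2)) ⊙ v2) = star (ρ w1 v1) * a * ρ w2 v2)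
    (hρ : ∀ a : A, Gen {c | ∃ w v, c = ρ w v} a) :
    ∃ η : (TF hB W).toFunctor ⋙ (TF hA V).toFunctor ⟶ CategoryTheory.Functor.id (HObj A),
      ∀ M : HObj A, IsUnitaryHom (η.app M) := by
  have gp : ∀ M : HObj A, ∀ x, Gen (Set.range fun p : M.carrier × W.obj.carrier × V.obj.carrier =>
      tt hA V (tt hB W p.1 p.2.1) p.2.2) x := by
    intro M x
    refine (tt_gen hA V _ x).mono ?_
    rintro _ ⟨⟨y, v⟩, rfl⟩
    refine (tt_gen hB W _ y).ind (fun y => Gen _ (tt hA V y v)) ?_ ?_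
    · intro ι y hy
      rw [tt_iSup]; exact Gen.iSup hy
    · rintro _ ⟨⟨m, w⟩, rfl⟩
      exact Gen.base ⟨(m, w, v), rfl⟩
  have gq : ∀ M : HObj A, ∀ x, Gen (Set.range fun p : M.carrier × W.obj.carrier × V.obj.carrier =>
      hact p.1 (ρ p.2.1 p.2.2)) x := by
    intro M x
    refine ess_ind (fun x => Gen _ x) (fun _ _ => Gen.iSup) ?_ x
    intro m a
    refine (hρ a).ind (fun a => Gen _ (hact m a)) ?_ ?_
    · intro ι y hy
      rw [hact_iSup]; exact Gen.iSup hy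
    · rintro _ ⟨w, v, rfl⟩
      exact Gen.base ⟨(m, w, v), rfl⟩
  have ex : ∀ M : HObj A, ∃ k : tO hA V (tO hB W M) ⟶ M,
      (∀ p : M.carrier × W.obj.carrier × V.obj.carrier,
        k ⊙ tt hA V (tt hB W p.1 p.2.1) p.2.2 = hact p.1 (ρ p.2.1 p.2.2)) ∧ IsUnitaryHom k := by
    intro M
    refine lemU (gp M) (gq M) ?_
    intro i j
    rw [tt_ip, tt_ip, h, hip_act_left, hip_act, qmul_assoc]
  choose k hk hu using ex
  refine ⟨{ app := k, naturality := fun M N f => ?_ }, hu⟩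
  change tm hA V (tm hB W f) ≫ k N = k M ≫ f
  refine hom_ext_gen (gp M) ?_
  rintro ⟨m, w, v⟩
  simp only [ap_comp, tm_tt]
  rw [hk N (_, _, _), hk M (_, _, _), ap_act]

end

section
variable {A B : Type u} [InvQuantale A] [InvQuantale B] (W : ImprimObj A B)

/-- the bimodule of an imprimitivity bimodule -/
def bimR : Bim A B where
  obj := { carrier := W.carrier, ess := W.imprim.ress, sep := W.imprim.rsep }
  l := fun a => mkH (W.lact a) (W.lact (star a)) (fun x y => W.imprim.bimod.ip_lact a x y)
  l_star := fun a => star_eq fun x y => W.imprim.bimod.ip_lact a x y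
  l_iSup := fun {ι} a x => by
    change W.lact _ x = ⨆ i, W.lact (a i) x
    rw [iSup, W.imprim.bimod.sSup_lact, iSup_range]

theorem lip_lact' (a : A) (x y : W.carrier) : W.lip x (W.lact a y) = W.lip x y * star a := by
  rw [← W.imprim.star_lip, ← W.imprim.lip_lact, qsm, W.imprim.star_lip]

/-- the conjugate bimodule of an imprimitivity bimodule -/
def bimL (hA : InvQuantale.MReg A) : Bim B A where
  obj := mkObj hA W.carrier (fun w a => W.lact (star a) w) W.lip W.imprim.lip_sSup
    W.imprim.star_lip (fun p q a => by rw [lip_lact', qss])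
    (fun m n h => W.imprim.lip_sep m n fun p => by
      rw [← W.imprim.star_lip, h, W.imprim.star_lip])
    (fun p => by
      refine (Gen.of_eq (S := {x | ∃ (a : A) (p : W.carrier), x = W.lact a p})
        (W.imprim.less p)).mono ?_
      rintro _ ⟨a, p, rfl⟩
      exact Gen.base ⟨p, star a, by rw [qss]⟩)
  l := fun b => mkH (fun w : W.carrier => qact w (star b)) (fun w : W.carrier => qact w b)
    (fun x y => (W.imprim.imp2 x y (star b)).trans (by rw [qss]; rfl))
  l_star := fun b => star_eq fun (x y : W.carrier) =>
    (W.imprim.imp2 x y (star b)).trans rfl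
  l_iSup := fun {ι} a x => by
    change qact (M := W.carrier) x (star (⨆ i, a i)) = ⨆ i, qact (M := W.carrier) x (star (a i))
    rw [Quantale.star_iSup, qact_iSup_right]

theorem converse (hA : InvQuantale.MReg A) (hB : InvQuantale.MReg B) :
      ∃ (F' : StarFunctor A B) (G' : StarFunctor B A)
        (η' : F'.toFunctor ⋙ G'.toFunctor ⟶ CategoryTheory.Functor.id (HObj A))
        (ζ' : G'.toFunctor ⋙ F'.toFunctor ⟶ CategoryTheory.Functor.id (HObj B)),
        (∀ M : HObj A, IsUnitaryHom (η'.app M)) ∧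
        (∀ N : HObj B, IsUnitaryHom (ζ'.app N)) ∧
        ∃ t : ∀ Y : HObj A, Y.carrier → W.carrier → (F'.toFunctor.obj Y).carrier,
          (∀ Y : HObj A, IsInteriorTensor A B W.lact (t Y)) ∧
          (∀ (Y Y' : HObj A) (f : Y ⟶ Y') (x : Y.carrier) (z : W.carrier),
            (F'.toFunctor.map f).1 (t Y x z) = t Y' (f.1 x) z) := by
  have I := W.imprim
  obtain ⟨η, hη⟩ := exists_unit hA hB (bimR W) (bimL W hA)
    (fun w v : W.carrier => W.lip w v) (by
      intro (w1 : W.carrier) (v1 : W.carrier) (w2 : W.carrier) (v2 : W.carrier) a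
      change W.lip v1 (qact v2 (star (qip B w1 (W.lact a w2)))) =
        star (W.lip w1 v1) * a * W.lip w2 v2
      rw [show star (qip B w1 (W.lact a w2)) = qip B (W.lact a w2) w1 from
        QPreHilb.star_ip _ _, I.bimod.ip_lact, ← I.imp1, lip_lact', lip_lact', qss,
        I.star_lip, I.star_lip])
    (fun a => Gen.of_eq (I.lfull a))
  obtain ⟨ζ, hζ⟩ := exists_unit hB hA (bimL W hA) (bimR W)
    (fun w v : W.carrier => qip B w v) (by
      intro (w1 : W.carrier) (v1 : W.carrier) (w2 : W.carrier) (v2 : W.carrier) b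
      change qip B v1 (W.lact (W.lip w1 (qact w2 (star b))) v2) =
        star (qip B w1 v1) * b * qip B w2 v2
      rw [I.imp1]
      have h1 := hip_act (M := (bimR W).obj) v1 w1 (qip B (qact w2 (star b)) v2)
      have h2 := hip_act_left (M := (bimR W).obj) w2 v2 (star b)
      have h3 := star_hip (M := (bimR W).obj) w1 v1
      refine h1.trans ?_
      refine (congrArg (fun c => _ * c) h2).trans ?_
      rw [qss, ← h3, ← qmul_assoc]
      rfl)
    (fun a => Gen.of_eq (I.rfull a))
  refine ⟨TF hB (bimR W), TF hA (bimL W hA), η, ζ, hη, hζ,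
    fun Y y w => tt hB (bimR W) (Y := Y) y w, fun Y => ?_, fun Y Y' f x z => ?_⟩
  · exact
    { ip_t := fun x₁ x₂ y₁ y₂ => tt_ip hB (bimR W) x₁ x₂ y₁ y₂
      sSup_t := fun S y => isSupMap_of_iSup (f := fun x => tt hB (bimR W) (Y := Y) x y)
        (fun ι x => tt_iSup hB (bimR W) x y) S
      t_sSup := fun x S => isSupMap_of_iSup (f := fun y => tt hB (bimR W) (Y := Y) x y)
        (fun ι y => tt_iSup_right hB (bimR W) x y) S
      gen := fun p => by
        refine Gen.eq ((tt_gen hB (bimR W) Y p).mono ?_)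
        rintro _ ⟨⟨y, w⟩, rfl⟩
        exact Gen.base ⟨y, w, rfl⟩ }
  · exact tm_tt hB (bimR W) f x z

end
end SM


/-- If `F : mreg-Hilb_A → mreg-Hilb_B` and `G` are equivalence
⋆-functors with `FG ≅ Id` and `GF ≅ Id` via unitary natural isomorphisms, then `A`
and `B` are strongly Morita equivalent; moreover `X = F(A)` (with the left action of
the Eilenberg–Watts theorem) is an imprimitivity `A`–`B` bimodule implementing the
equivalence, and `F ≅ (−)⊗̇_A X` naturally and unitarily.  Conversely, every
imprimitivity `A`–`B` bimodule implements such a functorial equivalence. -/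
theorem strong_morita_of_unitary_equivalence (A B : Type u)
    [InvQuantale A] [InvQuantale B]
    (hA : InvQuantale.MReg A) (hB : InvQuantale.MReg B)
    (F : StarFunctor A B) (G : StarFunctor B A)
    (η : F.toFunctor ⋙ G.toFunctor ⟶ CategoryTheory.Functor.id (HObj A))
    (ζ : G.toFunctor ⋙ F.toFunctor ⟶ CategoryTheory.Functor.id (HObj B))
    (hη : ∀ M : HObj A, IsUnitaryHom (η.app M))
    (hζ : ∀ N : HObj B, IsUnitaryHom (ζ.app N)) :
    Nonempty (ImprimObj A B) ∧
    (∃ lip : (F.toFunctor.obj (selfObj A hA)).carrier →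
        (F.toFunctor.obj (selfObj A hA)).carrier → A,
      IsImprim A B (F.toFunctor.obj (selfObj A hA)).carrier (EWact hA F) lip) ∧
    (∃ (P : HObj A → HObj B)
      (t : ∀ Y : HObj A,
        Y.carrier → (F.toFunctor.obj (selfObj A hA)).carrier → (P Y).carrier)
      (τ : ∀ Y : HObj A, P Y ⟶ F.toFunctor.obj Y),
      (∀ Y : HObj A, IsInteriorTensor A B (EWact hA F) (t Y)) ∧
      (∀ Y : HObj A, IsUnitaryHom (τ Y)) ∧
      (∀ (Y Y' : HObj A) (f : Y ⟶ Y') (g : P Y ⟶ P Y'),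
        (∀ x z, g.1 (t Y x z) = t Y' (f.1 x) z) →
        g ≫ τ Y' = τ Y ≫ F.toFunctor.map f)) ∧
    (∀ W : ImprimObj A B,
      ∃ (F' : StarFunctor A B) (G' : StarFunctor B A)
        (η' : F'.toFunctor ⋙ G'.toFunctor ⟶ CategoryTheory.Functor.id (HObj A))
        (ζ' : G'.toFunctor ⋙ F'.toFunctor ⟶ CategoryTheory.Functor.id (HObj B)),
        (∀ M : HObj A, IsUnitaryHom (η'.app M)) ∧
        (∀ N : HObj B, IsUnitaryHom (ζ'.app N)) ∧
        ∃ t : ∀ Y : HObj A, Y.carrier → W.carrier → (F'.toFunctor.obj Y).carrier,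
          (∀ Y : HObj A, IsInteriorTensor A B W.lact (t Y)) ∧
          (∀ (Y Y' : HObj A) (f : Y ⟶ Y') (x : Y.carrier) (z : W.carrier),
            (F'.toFunctor.map f).1 (t Y x z) = t Y' (f.1 x) z)) := by
  let E : SM.Eqv A B := ⟨hA, hB, F, G, η, ζ, hη, hζ⟩
  have h2 : IsImprim A B (F.toFunctor.obj (selfObj A hA)).carrier (EWact hA F) E.lip := E.isImprim
  refine ⟨⟨⟨(F.toFunctor.obj (selfObj A hA)).carrier, EWact hA F, E.lip, h2⟩⟩, ⟨E.lip, h2⟩,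
    ⟨fun Y => F.toFunctor.obj Y, fun Y y x => SM.ap (E.fm (SM.elt hA y)) x, fun Y => 𝟙 _,
      fun Y => E.tens Y, fun Y => ?_, fun Y Y' f g hg => ?_⟩, fun W => SM.converse W hA hB⟩
  · exact ⟨by rw [SM.hStar_id, Category.comp_id], by rw [SM.hStar_id, Category.comp_id]⟩
  · rw [Category.comp_id, Category.id_comp]
    apply SM.hom_ext
    intro p
    refine (E.genP Y p).ind (fun p => SM.ap g p = SM.ap (F.toFunctor.map f) p) ?_ ?_
    · intro ι x hx
      refine (SM.ap_iSup g x).trans (Eq.trans ?_ (SM.ap_iSup (F.toFunctor.map f) x).symm)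
      exact iSup_congr hx
    · rintro _ ⟨y, x, rfl⟩
      refine (hg y x).trans ?_
      have h3 := E.fm_comp (SM.elt hA y) f
      rw [SM.elt_comp] at h3
      exact congrArg (fun k => SM.ap k x) h3
end

section
/- Let A and B be m-regular involutive quantales. Then A and B are Morita equivalent if and only if the opposite quantales A^d and B^d are Morita equivalent. -/
universe u v w

set_option autoImplicit false

open CategoryTheory

section MoritaTransport

/-- An isomorphism of involutive quantales. -/
structure QIso (A B : Type u) [InvQuantale A] [InvQuantale B] where
  fwd : A → B
  inv : B → A
  inv_fwd : ∀ a, inv (fwd a) = a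
  to_inv : ∀ b, fwd (inv b) = b
  to_mul : ∀ a b, fwd (a * b) = fwd a * fwd b
  to_star : ∀ a, fwd (star a) = star (fwd a)
  to_sSup : ∀ S : Set A, fwd (sSup S) = ⨆ a ∈ S, fwd a
  inv_sSup : ∀ S : Set B, inv (sSup S) = ⨆ a ∈ S, inv a

def QIso.symm {A B : Type u} [InvQuantale A] [InvQuantale B] (e : QIso A B) : QIso B A where
  fwd := e.inv
  inv := e.fwd
  inv_fwd := e.to_inv
  to_inv := e.inv_fwd
  to_mul a b := by
    rw [← e.inv_fwd (e.inv a * e.inv b), e.to_mul, e.to_inv, e.to_inv]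
  to_star a := by
    rw [← e.inv_fwd (star (e.inv a)), e.to_star, e.to_inv]
  to_sSup := e.inv_sSup
  inv_sSup := e.to_sSup

theorem QIso.to_iSup {A B : Type u} [InvQuantale A] [InvQuantale B] (e : QIso A B)
    {ι : Sort w} (f : ι → A) : e.fwd (⨆ i, f i) = ⨆ i, e.fwd (f i) := by
  rw [iSup, e.to_sSup, iSup_range]

theorem hStar_unique {A : Type u} [InvQuantale A] {M N : HObj A} (f : M ⟶ N) (g : N ⟶ M)
    (h : IsAdjointPair A f.1 g.1) : hStar f = g := by
  apply Subtype.ext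
  funext n
  apply QHilb.ip_sep (A := A)
  intro p
  exact (hStar_adj f p n).symm.trans (h p n)

theorem hStar_hom_adj {A : Type u} [InvQuantale A] {M N : HObj A} (f : M ⟶ N) :
    hStar (hStar f) = f :=
  hStar_unique _ _ (hStar_adj f).symm'

theorem hStar_comp {A : Type u} [InvQuantale A] {M N P : HObj A} (f : M ⟶ N) (g : N ⟶ P) :
    hStar (f ≫ g) = hStar g ≫ hStar f :=
  hStar_unique _ _ fun m p => (hStar_adj g (f.1 m) p).trans (hStar_adj f m _)

theorem hStar_id {A : Type u} [InvQuantale A] (M : HObj A) : hStar (𝟙 M) = 𝟙 M :=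
  hStar_unique _ _ fun _ _ => rfl

theorem IsUnitaryHom.comp {A : Type u} [InvQuantale A] {M N P : HObj A} {f : M ⟶ N}
    {g : N ⟶ P} (hf : IsUnitaryHom f) (hg : IsUnitaryHom g) : IsUnitaryHom (f ≫ g) := by
  constructor
  · rw [hStar_comp, Category.assoc, ← Category.assoc g, hg.1, Category.id_comp, hf.1]
  · rw [hStar_comp, Category.assoc, ← Category.assoc _ f, hf.2, Category.id_comp, hg.2]

theorem IsUnitaryHom.map {A B : Type u} [InvQuantale A] [InvQuantale B] (F : StarFunctor A B)
    {M N : HObj A} {f : M ⟶ N} (hf : IsUnitaryHom f) : IsUnitaryHom (F.toFunctor.map f) := by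
  constructor
  · rw [← F.map_star, ← F.toFunctor.map_comp, hf.1, F.toFunctor.map_id]
  · rw [← F.map_star, ← F.toFunctor.map_comp, hf.2, F.toFunctor.map_id]

/-- Composition of ⋆-functors. -/
def StarFunctor.comp {A B C : Type u} [InvQuantale A] [InvQuantale B] [InvQuantale C]
    (F : StarFunctor A B) (G : StarFunctor B C) : StarFunctor A C where
  toFunctor := F.toFunctor ⋙ G.toFunctor
  map_star f := by
    simp only [Functor.comp_map, F.map_star, G.map_star]
  map_hSup S := by
    rw [Functor.comp_map, F.map_hSup, G.map_hSup, Set.image_image]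
    rfl

theorem comp_square {C : Type v} [Category.{w} C] {X1 X2 X3 X4 X5 X6 : C}
    {x : X1 ⟶ X2} {y : X2 ⟶ X3} {z : X1 ⟶ X4} {t : X4 ⟶ X3} {s : X3 ⟶ X5} {r : X4 ⟶ X6}
    {f : X6 ⟶ X5} (e2 : x ≫ y = z ≫ t) (e1 : t ≫ s = r ≫ f) :
    x ≫ y ≫ s = (z ≫ r) ≫ f := by
  rw [Category.assoc, ← e1, ← Category.assoc, ← Category.assoc, e2]

theorem Morita.symm {A B : Type u} [InvQuantale A] [InvQuantale B] (h : Morita A B) :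
    Morita B A := by
  obtain ⟨F, G, η, ζ, h1, h2⟩ := h
  exact ⟨G, F, ζ, η, h2, h1⟩

theorem Morita.trans {A B C : Type u} [InvQuantale A] [InvQuantale B] [InvQuantale C]
    (h : Morita A B) (h' : Morita B C) : Morita A C := by
  obtain ⟨F, G, η, ζ, h1, h2⟩ := h
  obtain ⟨F', G', η', ζ', h1', h2'⟩ := h'
  refine ⟨F.comp F', G'.comp G,
    { app := fun M => G.toFunctor.map (η'.app (F.toFunctor.obj M)) ≫ η.app M
      naturality := ?_ },
    { app := fun M => F'.toFunctor.map (ζ.app (G'.toFunctor.obj M)) ≫ ζ'.app M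
      naturality := ?_ }, ?_, ?_⟩
  · intro M N f
    have e1 := η.naturality f
    have e2 := congrArg G.toFunctor.map (η'.naturality (F.toFunctor.map f))
    simp only [Functor.map_comp, Functor.comp_map, Functor.id_map] at e1 e2
    exact comp_square e2 e1
  · intro M N f
    have e1 := ζ'.naturality f
    have e2 := congrArg F'.toFunctor.map (ζ.naturality (G'.toFunctor.map f))
    simp only [Functor.map_comp, Functor.comp_map, Functor.id_map] at e1 e2
    exact comp_square e2 e1
  · intro M
    exact IsUnitaryHom.comp (IsUnitaryHom.map G (h1' _)) (h1 M)
  · intro M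
    exact IsUnitaryHom.comp (IsUnitaryHom.map F' (h2 _)) (h2' M)

/-- Transport of a Hilbert module structure along an isomorphism. -/
def QIso.hilb {A B : Type u} [InvQuantale A] [InvQuantale B] (e : QIso A B)
    (M : Type u) [CompleteLattice M] [QHilb A M] : QHilb B M where
  act m b := qact m (e.inv b)
  act_mul m a b := by
    have h : e.inv (a * b) = e.inv a * e.inv b := e.symm.to_mul a b
    rw [h]
    exact QMod.act_mul _ _ _
  sSup_act S b := QMod.sSup_act S _
  act_sSup m S := by
    rw [e.inv_sSup]
    simp only [qact_iSup_right]
  ip m n := e.fwd (qip A m n)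
  ip_mul m n b := by
    have h : qip A m (qact n (e.inv b)) = qip A m n * e.inv b := (QPreHilb.ip_mul _ _ _).symm
    rw [h, e.to_mul, e.to_inv]
  sSup_ip S n := by
    have h : qip A (sSup S) n = ⨆ m ∈ S, qip A m n := QPreHilb.sSup_ip S n
    rw [h]
    simp only [e.to_iSup]
  ip_sSup m S := by
    have h : qip A m (sSup S) = ⨆ n ∈ S, qip A m n := QPreHilb.ip_sSup m S
    rw [h]
    simp only [e.to_iSup]
  star_ip m n := by
    have h : star (qip A m n) = qip A n m := QPreHilb.star_ip m n
    rw [← e.to_star, h]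
  ip_sep m n h := by
    apply QHilb.ip_sep (A := A)
    intro p
    have := congrArg e.inv (h p)
    rwa [e.inv_fwd, e.inv_fwd] at this

def QIso.obj {A B : Type u} [InvQuantale A] [InvQuantale B] (e : QIso A B) (M : HObj A) :
    HObj B where
  carrier := M.carrier
  lat := M.lat
  str := e.hilb M.carrier
  ess := by
    intro m
    refine (M.ess m).trans (congrArg sSup ?_)
    ext x
    constructor
    · rintro ⟨⟨p, a, rfl⟩, h⟩
      refine ⟨⟨p, e.fwd a, ?_⟩, h⟩
      change qact p a = qact p (e.inv (e.fwd a))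
      rw [e.inv_fwd]
    · rintro ⟨⟨p, b, rfl⟩, h⟩
      exact ⟨⟨p, e.inv b, rfl⟩, h⟩
  sep := by
    intro m n h
    apply M.sep
    intro a
    have h' : qact m (e.inv (e.fwd a)) = qact n (e.inv (e.fwd a)) := h (e.fwd a)
    rwa [e.inv_fwd] at h'

/-- Transport of a morphism. -/
def QIso.mapHom {A B : Type u} [InvQuantale A] [InvQuantale B] (e : QIso A B)
    {M N : HObj A} (f : M ⟶ N) : e.obj M ⟶ e.obj N :=
  ⟨f.1, f.2.choose, fun m n => congrArg e.fwd (f.2.choose_spec m n)⟩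

/-- Transport as a ⋆-functor. -/
def QIso.functor {A B : Type u} [InvQuantale A] [InvQuantale B] (e : QIso A B) :
    StarFunctor A B where
  toFunctor :=
    { obj := e.obj
      map := fun f => e.mapHom f
      map_id := fun _ => rfl
      map_comp := fun _ _ => rfl }
  map_star f := by
    symm
    apply hStar_unique
    exact fun m n => congrArg e.fwd (hStar_adj f m n)
  map_hSup {M N} S := by
    apply Subtype.ext
    funext m
    exact (iSup_image (α := N.carrier) (t := S) (f := fun f : M ⟶ N => e.mapHom f)
      (g := fun g : e.obj M ⟶ e.obj N => g.1 m)).symm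

def QIso.unit {A B : Type u} [InvQuantale A] [InvQuantale B] (e : QIso A B) :
    e.functor.toFunctor ⋙ e.symm.functor.toFunctor ⟶ 𝟭 (HObj A) where
  app M := ⟨fun m : M.carrier => m, fun m : M.carrier => m,
    fun m n => (e.inv_fwd (qip A (M := M.carrier) m n)).symm⟩
  naturality _ _ _ := rfl

theorem QIso.unit_unitary {A B : Type u} [InvQuantale A] [InvQuantale B] (e : QIso A B)
    (M : HObj A) : IsUnitaryHom (e.unit.app M) := by
  have h : hStar (e.unit.app M) = ⟨fun m : M.carrier => m, fun m : M.carrier => m,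
      fun m n => (e.inv_fwd (qip A (M := M.carrier) m n))⟩ := by
    apply hStar_unique
    exact fun m n => (e.inv_fwd (qip A (M := M.carrier) m n)).symm
  constructor
  · rw [h]; rfl
  · rw [h]; rfl

theorem QIso.morita {A B : Type u} [InvQuantale A] [InvQuantale B] (e : QIso A B) :
    Morita A B :=
  ⟨e.functor, e.symm.functor, e.unit, e.symm.unit, e.unit_unitary, e.symm.unit_unitary⟩

/-- The involution is an isomorphism from a quantale to its opposite. -/
def dualIso (A : Type u) [iA : InvQuantale A] : @QIso A A iA (InvQuantale.dual A) :=
  @QIso.mk A A iA (InvQuantale.dual A) (fun a => star a) (fun a => star a)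
    InvQuantale.qstar_star InvQuantale.qstar_star InvQuantale.qstar_mul (fun _ => rfl)
    InvQuantale.star_sSup InvQuantale.star_sSup

theorem morita_dual (A : Type u) [iA : InvQuantale A] :
    @Morita A A iA (InvQuantale.dual A) :=
  @QIso.morita A A iA (InvQuantale.dual A) (dualIso A)

end MoritaTransport

/-- Two m-regular involutive quantales `A` and `B` are Morita
equivalent iff the opposite quantales `A^d` and `B^d` are Morita equivalent. -/
theorem morita_iff_dual_morita (A B : Type u) [InvQuantale A] [InvQuantale B]
    (hA : InvQuantale.MReg A) (hB : InvQuantale.MReg B) :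
    Morita A B ↔ @Morita A B (InvQuantale.dual A) (InvQuantale.dual B) := by
  have eA := morita_dual A
  have eB := morita_dual B
  constructor
  · intro h
    exact @Morita.trans A A B (InvQuantale.dual A) _ (InvQuantale.dual B)
      (@Morita.symm A A _ (InvQuantale.dual A) eA)
      (@Morita.trans A B B _ _ (InvQuantale.dual B) h eB)
  · intro h
    exact @Morita.trans A A B _ (InvQuantale.dual A) _ eA
      (@Morita.trans A B B (InvQuantale.dual A) (InvQuantale.dual B) _ h
        (@Morita.symm B B _ (InvQuantale.dual B) eB))
end
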